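/- arXiv:2401.10734 — 9 statements merged into one kernel-verified Lean document; each statement's English description precedes it below -/
import Mathlib

section
/- Suppose λ1 = λ2 = λ > 0 and (π, ν1, ν2) satisfies the basic adjoint relationship. Define sequences a_{2n} = (n+2)(2n+5), a_{2n+1} = a_{2n}, b_{2n} = (n+2)(2n+3), b_{2n+1} = b_{2n+2}, and c_n = (−1)^n · binom(n+7,7) · (n+4)/4, and set p(u,v) = λ² Σ_{n≥0} c_n exp(−λ(a_n u + b_n v)). Then π is absolutely continuous with respect to Lebesgue measure on (0,∞)², with density π(u,v) = 420 (p(u,v) + p(v,u)). -/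
open MeasureTheory Set

/-- `a_{2m} = (m+2)(2m+5)`, `a_{2m+1} = a_{2m}`; hence `a_n` depends only on `m = n/2`. -/
noncomputable def aSymSeq (n : ℕ) : ℝ :=
  let m : ℝ := ((n / 2 : ℕ) : ℝ)
  (m + 2) * (2 * m + 5)

/-- `b_{2m} = (m+2)(2m+3)`, `b_{2m+1} = b_{2m+2}`. -/
noncomputable def bSymSeq (n : ℕ) : ℝ :=
  let m : ℝ := ((n / 2 : ℕ) : ℝ)
  if Even n then (m + 2) * (2 * m + 3) else (m + 3) * (2 * m + 5)

/-- `c_n = (−1)^n binom(n+7,7) (n+4)/4`. -/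
noncomputable def cSymSeq (n : ℕ) : ℝ :=
  (-1 : ℝ) ^ n * (Nat.choose (n + 7) 7 : ℝ) * ((n : ℝ) + 4) / 4

/-- `p(u,v) = λ² Σ_{n≥0} c_n exp(−λ(a_n u + b_n v))`. -/
noncomputable def pSym (lam : ℝ) (u v : ℝ) : ℝ :=
  lam ^ 2 * ∑' n : ℕ, cSymSeq n * Real.exp (-(lam * (aSymSeq n * u + bSymSeq n * v)))

/-- The triangular number `k (k + 1) / 2`, for real `k`. -/
noncomputable def triangular (k : ℝ) : ℝ := k * (k + 1) / 2

lemma HasSum.of_eq {ι E : Type*} [AddCommMonoid E] [TopologicalSpace E] {f g : ι → E} {a b : E}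
    (h : HasSum f a) (hf : ∀ n, g n = f n) (ha : b = a) : HasSum g b := by
  rwa [funext hf, ha]

lemma hasSum_alternating_pi_div_sin {z : ℂ} (hz : z ∈ Complex.integerComplement) :
    HasSum (fun n : ℕ => (-1 : ℂ) ^ (n + 1) * (1 / (z - (n + 1)) + 1 / (z + (n + 1))))
      (Real.pi / Complex.sin (Real.pi * z) - 1 / z) := by
  have hz2 : z / 2 ∈ Complex.integerComplement := by
    rw [Complex.mem_integerComplement_iff] at hz ⊢
    rintro ⟨n, hn⟩
    exact hz ⟨2 * n, by push_cast; rw [hn]; ring⟩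
  have key : ∀ x ∈ Complex.integerComplement,
      HasSum (fun n : ℕ => 1 / (x - (n + 1)) + 1 / (x + (n + 1)))
        (Real.pi * Complex.cot (Real.pi * x) - 1 / x) := by
    intro x hx
    rw [cot_series_rep' hx]
    exact (summable_cotTerm hx).hasSum
  have h1 := key z hz
  have h2 : HasSum (fun n : ℕ => (1 + (-1 : ℂ) ^ (n + 1)) *
      (1 / (z - (n + 1)) + 1 / (z + (n + 1))))
      (Real.pi * Complex.cot (Real.pi * (z / 2)) - 1 / (z / 2)) := by
    have hinj : Function.Injective (fun n : ℕ => 2 * n + 1) := fun a b h => by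
      simpa using h
    rw [← hinj.hasSum_iff]
    · convert key _ hz2 using 1
      funext n
      have e1 : ∀ m : ℤ, z - m ≠ 0 := fun m h => by
        rw [Complex.mem_integerComplement_iff] at hz
        exact hz ⟨m, (sub_eq_zero.1 h).symm⟩
      have a1 := e1 (2 * (n + 1))
      have a2 := e1 (-(2 * (n + 1)))
      push_cast at a1 a2
      have b1 : z / 2 - (n + 1) ≠ 0 := fun h => a1 (by linear_combination 2 * h)
      have b2 : z / 2 + (n + 1) ≠ 0 := fun h => a2 (by linear_combination 2 * h)
      have a3 : z - (2 * n + 1 + 1) ≠ 0 := fun h => a1 (by linear_combination h)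
      have a4 : z + (2 * n + 1 + 1) ≠ 0 := fun h => a2 (by linear_combination h)
      have hp : (-1 : ℂ) ^ (2 * n + 1 + 1) = 1 := by
        rw [show 2 * n + 1 + 1 = 2 * (n + 1) by ring, pow_mul]; simp
      simp only [Function.comp, hp]
      push_cast
      have e5 : z / 2 - (n + 1) = (z - (2 * n + 1 + 1)) / 2 := by ring
      have e6 : z / 2 + (n + 1) = (z + (2 * n + 1 + 1)) / 2 := by ring
      rw [e5, e6]
      field_simp
      ring
    · intro n hn
      have : Even n := by
        by_contra h
        obtain ⟨m, rfl⟩ := Nat.not_even_iff_odd.1 h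
        exact hn ⟨m, rfl⟩
      simp [this.add_one.neg_one_pow]
  have hs := h2.sub h1
  refine hs.of_eq (fun n => by ring) ?_
  · have hs1 : Complex.sin (Real.pi * z) ≠ 0 := sin_pi_mul_ne_zero hz
    have hs2 : Complex.sin (Real.pi * (z / 2)) ≠ 0 := sin_pi_mul_ne_zero hz2
    have hz0 : z ≠ 0 := by
      rw [Complex.mem_integerComplement_iff] at hz
      rintro rfl
      exact hz ⟨0, by simp⟩
    have e : (Real.pi * z : ℂ) = 2 * (Real.pi * (z / 2)) := by ring
    have hc : Complex.cot (Real.pi * (z / 2)) - Complex.cot (Real.pi * z)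
        = 1 / Complex.sin (Real.pi * z) := by
      rw [e] at hs1 ⊢
      rw [Complex.cot, Complex.cot, Complex.sin_two_mul, Complex.cos_two_mul]
      rw [Complex.sin_two_mul] at hs1
      have : Complex.cos (Real.pi * (z / 2)) ≠ 0 := fun h => hs1 (by rw [h]; simp)
      field_simp
      ring
    have : (Real.pi : ℂ) / Complex.sin (Real.pi * z) = Real.pi * (1 / Complex.sin (Real.pi * z)) := by
      ring
    rw [this, ← hc]
    field_simp
    ring

/-- The function `2π / cosh (π √(2X - 1/4))`. -/
noncomputable def sechSum (X : ℝ) : ℝ :=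
  2 * Real.pi / Real.cosh (Real.pi * √(2 * X - 1 / 4))

lemma add_triangular_pos {X : ℝ} (hX : 1 ≤ X) (k : ℝ) : 0 < X + triangular k := by
  unfold triangular
  nlinarith [sq_nonneg (k + 1 / 2)]

lemma hasSum_odd_alternating {X : ℝ} (hX : 1 ≤ X) :
    HasSum (fun n : ℕ => (-1 : ℝ) ^ (n + 1) *
      (((n + 1 : ℝ) + 1 / 2) / (X + triangular (n + 1)) + (1 / 2 - (n + 1 : ℝ)) / (X + triangular n)))
      (sechSum X - 1 / (2 * X)) := by
  set τ := √(2 * X - 1 / 4) with hτ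
  have hτ2 : τ ^ 2 = 2 * X - 1 / 4 := Real.sq_sqrt (by linarith)
  have hτpos : 0 < τ := Real.sqrt_pos.2 (by linarith)
  set z : ℂ := ⟨1 / 2, τ⟩ with hz
  have hzc : z ∈ Complex.integerComplement := by
    rw [Complex.mem_integerComplement_iff]
    rintro ⟨n, hn⟩
    have := congrArg Complex.im hn
    simp [hz] at this
    exact hτpos.ne this
  have h := (Complex.reCLM.hasSum (hasSum_alternating_pi_div_sin hzc)).mul_left 2
  have hsin : Complex.sin (Real.pi * z) = (Real.cosh (Real.pi * τ) : ℂ) := by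
    have : (Real.pi * z : ℂ) = (Real.pi * τ : ℝ) * Complex.I + Real.pi / 2 := by
      apply Complex.ext <;> simp [hz]
      ring
    rw [this, Complex.sin_add_pi_div_two, Complex.cos_mul_I, Complex.ofReal_cosh]
  have hre : ∀ x : ℝ, (1 / (z + x)).re = (1 / 2 + x) / (2 * (X + triangular x)) := by
    intro x
    have := add_triangular_pos hX x
    rw [one_div, Complex.inv_re, Complex.normSq_apply]
    simp only [hz, Complex.add_re, Complex.add_im, Complex.ofReal_re, Complex.ofReal_im]
    congr 1
    unfold triangular
    nlinarith
  refine h.of_eq (fun n => ?_) ?_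
  · have e : ((-1 : ℂ) ^ (n + 1)) = (((-1 : ℝ) ^ (n + 1) : ℝ) : ℂ) := by push_cast; rfl
    have e1 := hre (n + 1)
    have e2 := hre (-(n + 1))
    have e3 : triangular (-((n : ℝ) + 1)) = triangular n := by unfold triangular; ring
    rw [e3] at e2
    simp only [Complex.reCLM_apply]
    rw [e, Complex.re_ofReal_mul, Complex.add_re]
    push_cast at e1 e2
    rw [e1, show z - ((n : ℂ) + 1) = z + -(n + 1) by ring, e2]
    have := add_triangular_pos hX n
    have := add_triangular_pos hX (n + 1)
    field_simp
    ring
  · rw [Complex.reCLM_apply, hsin, Complex.sub_re]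
    have := hre 0
    simp only [Complex.ofReal_zero, add_zero] at this
    rw [this, ← Complex.ofReal_div, Complex.ofReal_re, sechSum, ← hτ]
    unfold triangular
    have : Real.cosh (Real.pi * τ) > 0 := Real.cosh_pos _
    field_simp
    ring

lemma hasSum_even_alternating {X : ℝ} (hX : 1 ≤ X) :
    HasSum (fun n : ℕ => (-1 : ℝ) ^ (n + 1) *
      (1 / (X + triangular (n + 1)) + 1 / (X + triangular n))) (-1 / X) := by
  have hs : Summable (fun n : ℕ => (-1 : ℝ) ^ n * (1 / (X + triangular n))) := by
    have h2 : Summable (fun n : ℕ => 4 * (1 / ((n + 1 : ℕ) : ℝ) ^ 2)) :=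
      ((summable_nat_add_iff 1).2 (Real.summable_one_div_nat_pow.2 one_lt_two)).mul_left 4
    refine Summable.of_norm_bounded h2 fun n => ?_
    have hp := add_triangular_pos hX n
    rw [norm_mul, norm_pow, norm_neg, norm_one, one_pow, one_mul, Real.norm_of_nonneg (by positivity),
      mul_one_div, div_le_div_iff₀ hp (by positivity)]
    have : (0 : ℝ) ≤ n := n.cast_nonneg
    unfold triangular
    push_cast
    nlinarith
  have h1 := hs.hasSum
  have h2 := (hasSum_nat_add_iff' 1).2 h1
  have h3 := h2.sub h1
  refine h3.of_eq (fun n => ?_) ?_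
  · push_cast
    ring
  · simp [triangular, neg_div]

/-- The coefficient `(-1)^k k² (k² - 1) (k² - 4) (k² - 9) / 20160` without its sign. -/
noncomputable def coeffPoly (k : ℝ) : ℝ :=
  k ^ 2 * (k ^ 2 - 1) * (k ^ 2 - 4) * (k ^ 2 - 9) / 20160

/-- The Laplace transform of the symmetrised `k`-th exponential. -/
noncomputable def pairKernel (X Y k : ℝ) : ℝ :=
  1 / ((X + triangular k) * (Y + triangular (k - 1)))
    + 1 / ((X + triangular (k - 1)) * (Y + triangular k))

/-- Even polynomial part of the partial fraction expansion of `coeffPoly k * pairKernel X Y k`. -/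
noncomputable def polyPart (X Y k : ℝ) : ℝ :=
  (k ^ 4 - (2 * X + 2 * Y + 13) * k ^ 2
    + (49 - 4 * X * Y + (2 * X + 2 * Y - 1) * (2 * X + 2 * Y + 13))) / 5040

/-- The kernel of the basic adjoint relationship. -/
noncomputable def parabola (X Y : ℝ) : ℝ := (X - Y) ^ 2 + X + Y

/-- Coefficient of the odd part at the poles in `X`. -/
noncomputable def oddCoeff (X Y : ℝ) : ℝ :=
  (Y - X / 2) * (X * (X + 1) * (X + 3)) / (630 * parabola X Y)

/-- Coefficient of the even part at the poles in `X`. -/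
noncomputable def evenCoeff (X Y : ℝ) : ℝ :=
  (X * Y - X ^ 2 - 5 * X / 2 - Y) * (X * (X + 1) * (X + 3)) / (1260 * parabola X Y)

/-- The Laplace transform of the invariant measure in normalised coordinates. -/
noncomputable def laplaceFormula (X Y : ℝ) : ℝ :=
  420 * (oddCoeff X Y * sechSum X + oddCoeff Y X * sechSum Y)

lemma parabola_pos {X Y : ℝ} (hX : 1 ≤ X) (hY : 1 ≤ Y) : 0 < parabola X Y := by
  unfold parabola; nlinarith [sq_nonneg (X - Y)]

lemma coeffPoly_mul_single {X Y k : ℝ} (hX : 1 ≤ X) (hY : 1 ≤ Y) :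
    coeffPoly k * (1 / ((X + triangular k) * (Y + triangular (k - 1))))
      = polyPart X Y k + (X - Y) * k / 2520
        + (oddCoeff X Y * (k + 1 / 2) + evenCoeff X Y) / (X + triangular k)
        + (oddCoeff Y X * (1 / 2 - k) + evenCoeff Y X) / (Y + triangular (k - 1)) := by
  have h1 := add_triangular_pos hX k
  have h2 := add_triangular_pos hY (k - 1)
  have h3 := parabola_pos hX hY
  have h4 : parabola Y X = parabola X Y := by unfold parabola; ring
  unfold oddCoeff evenCoeff
  rw [h4]
  field_simp
  unfold coeffPoly polyPart triangular parabola
  ring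

lemma hasSum_coeffPoly_mul_pairKernel_sub {X Y : ℝ} (hX : 1 ≤ X) (hY : 1 ≤ Y) :
    HasSum (fun n : ℕ => (-1 : ℝ) ^ (n + 1) *
      (coeffPoly (n + 1) * pairKernel X Y (n + 1) - 2 * polyPart X Y (n + 1)))
      (laplaceFormula X Y / 420 + polyPart X Y 0) := by
  have hX1 := (hasSum_odd_alternating hX).mul_left (oddCoeff X Y)
  have hY1 := (hasSum_odd_alternating hY).mul_left (oddCoeff Y X)
  have hX2 := (hasSum_even_alternating hX).mul_left (evenCoeff X Y)
  have hY2 := (hasSum_even_alternating hY).mul_left (evenCoeff Y X)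
  refine ((hX1.add hY1).add (hX2.add hY2)).of_eq (fun n => ?_) ?_
  · have e : (-(n + 1 : ℝ) - 1) = -((n + 1) + 1) := by ring
    have h1 := coeffPoly_mul_single (k := n + 1) hX hY
    have h2 := coeffPoly_mul_single (k := n + 1) hY hX
    have e1 : polyPart Y X (n + 1) = polyPart X Y (n + 1) := by unfold polyPart; ring
    rw [e1] at h2
    rw [add_sub_cancel_right] at h1 h2
    unfold pairKernel
    rw [mul_add, add_sub_cancel_right, h1, mul_comm (X + triangular n), h2]
    ring
  · have hp := parabola_pos hX hY
    have h4 : parabola Y X = parabola X Y := by unfold parabola; ring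
    unfold laplaceFormula
    have : polyPart X Y 0 = -(oddCoeff X Y / (2 * X)) - oddCoeff Y X / (2 * Y)
        - evenCoeff X Y / X - evenCoeff Y X / Y := by
      unfold oddCoeff evenCoeff polyPart
      rw [h4]
      field_simp
      unfold parabola
      ring
    rw [this]
    ring

/-- The third difference of `φ` along the diagonal. -/
def diagDiff (φ : ℝ → ℝ → ℝ) (X Y : ℝ) : ℝ :=
  φ X Y - 3 * φ (X + 1) (Y + 1) + 3 * φ (X + 2) (Y + 2) - φ (X + 3) (Y + 3)

lemma hasSum_diagDiff {X Y : ℝ} (hX : 1 ≤ X) (hY : 1 ≤ Y) :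
    HasSum (fun n : ℕ => (-1 : ℝ) ^ n * coeffPoly (n + 4) *
      diagDiff (fun X Y => pairKernel X Y (n + 4)) X Y) (diagDiff laplaceFormula X Y / 420) := by
  have h0 := hasSum_coeffPoly_mul_pairKernel_sub hX hY
  have h1 := hasSum_coeffPoly_mul_pairKernel_sub (X := X + 1) (Y := Y + 1) (by linarith) (by linarith)
  have h2 := hasSum_coeffPoly_mul_pairKernel_sub (X := X + 2) (Y := Y + 2) (by linarith) (by linarith)
  have h3 := hasSum_coeffPoly_mul_pairKernel_sub (X := X + 3) (Y := Y + 3) (by linarith) (by linarith)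
  have h : HasSum (fun n : ℕ => (-1 : ℝ) ^ (n + 1) * coeffPoly (n + 1) *
      diagDiff (fun X Y => pairKernel X Y (n + 1)) X Y) (diagDiff laplaceFormula X Y / 420) := by
    refine (((h0.sub (h1.mul_left 3)).add (h2.mul_left 3)).sub h3).of_eq (fun n => ?_) ?_
    · unfold diagDiff polyPart
      ring
    · unfold diagDiff polyPart
      ring
  refine ((hasSum_nat_add_iff' 3).2 h).of_eq (fun n => ?_) ?_
  · have e : ((n + 3 : ℕ) : ℝ) + 1 = n + 4 := by push_cast; ring
    rw [e]
    ring
  · simp [Finset.sum_range_succ, coeffPoly]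
    norm_num

section HalfPlane

open Filter Topology

lemma norm_exp_neg_mul_le_one {z : ℂ} (hz : 0 ≤ z.re) {t : ℝ} (ht : 0 ≤ t) :
    ‖Complex.exp (-z * t)‖ ≤ 1 := by
  rw [Complex.norm_exp, Real.exp_le_one_iff]
  simp only [Complex.mul_re, Complex.neg_re, Complex.neg_im, Complex.ofReal_re, Complex.ofReal_im]
  nlinarith [mul_nonneg hz ht]

variable {α : Type*} [MeasurableSpace α] {μ : Measure α} {g : α → ℂ} {φ : α → ℝ}

lemma aestronglyMeasurable_mul_exp (hg : Measurable g) (hφ : Measurable φ) (z : ℂ) :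
    AEStronglyMeasurable (fun a => g a * Complex.exp (-z * φ a)) μ := by
  have : Measurable (fun a => g a * Complex.exp (-z * φ a)) := by fun_prop
  exact this.aestronglyMeasurable

lemma norm_mul_exp_le_one (hg1 : ∀ᵐ a ∂μ, ‖g a‖ ≤ 1) (hφ0 : ∀ᵐ a ∂μ, 0 ≤ φ a) {z : ℂ}
    (hz : 0 ≤ z.re) : ∀ᵐ a ∂μ, ‖g a * Complex.exp (-z * φ a)‖ ≤ 1 := by
  filter_upwards [hg1, hφ0] with a h1 h2
  rw [norm_mul]
  exact mul_le_one₀ h1 (norm_nonneg _) (norm_exp_neg_mul_le_one hz h2)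

lemma continuousOn_integral_mul_exp [IsFiniteMeasure μ] (hg : Measurable g) (hφ : Measurable φ)
    (hg1 : ∀ᵐ a ∂μ, ‖g a‖ ≤ 1) (hφ0 : ∀ᵐ a ∂μ, 0 ≤ φ a) :
    ContinuousOn (fun z : ℂ => ∫ a, g a * Complex.exp (-z * φ a) ∂μ) {z | 0 ≤ z.re} := by
  refine continuousOn_of_dominated (bound := fun _ => 1)
    (fun z _ => aestronglyMeasurable_mul_exp hg hφ z)
    (fun z hz => norm_mul_exp_le_one hg1 hφ0 hz) (integrable_const _)
    (Eventually.of_forall fun a => ?_)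
  fun_prop

lemma differentiableOn_integral_mul_exp [IsFiniteMeasure μ] (hg : Measurable g) (hφ : Measurable φ)
    (hg1 : ∀ᵐ a ∂μ, ‖g a‖ ≤ 1) (hφ0 : ∀ᵐ a ∂μ, 0 ≤ φ a) :
    DifferentiableOn ℂ (fun z : ℂ => ∫ a, g a * Complex.exp (-z * φ a) ∂μ) {z | 0 < z.re} := by
  intro z₀ hz₀
  have hz₀' : 0 < z₀.re := hz₀
  have hs : {z : ℂ | z₀.re / 2 < z.re} ∈ 𝓝 z₀ :=
    (isOpen_lt continuous_const Complex.continuous_re).mem_nhds (by simpa using hz₀')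
  have hm : Measurable (fun a => g a * (Complex.exp (-z₀ * φ a) * (-1 * φ a))) := by fun_prop
  have h := hasDerivAt_integral_of_dominated_loc_of_deriv_le (μ := μ) (𝕜 := ℂ) (x₀ := z₀)
    (F := fun z a => g a * Complex.exp (-z * φ a))
    (F' := fun z a => g a * (Complex.exp (-z * φ a) * (-1 * φ a)))
    (bound := fun _ => 2 / z₀.re) hs
    (Eventually.of_forall fun z => aestronglyMeasurable_mul_exp hg hφ z)
    (Integrable.of_bound (aestronglyMeasurable_mul_exp hg hφ z₀) 1
      (norm_mul_exp_le_one hg1 hφ0 hz₀'.le)) hm.aestronglyMeasurable ?_ (integrable_const _) ?_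
  · exact h.2.differentiableAt.differentiableWithinAt
  · filter_upwards [hg1, hφ0] with a h1 h2 z hz
    have hz' : z₀.re / 2 < z.re := hz
    rw [norm_mul]
    refine (mul_le_of_le_one_left (norm_nonneg _) h1).trans ?_
    rw [norm_mul, Complex.norm_exp, neg_one_mul, norm_neg, Complex.norm_real, Real.norm_of_nonneg h2]
    have e : (-z * (φ a : ℂ)).re = -(z.re * φ a) := by simp
    rw [e]
    have h3 : Real.exp (-(z.re * φ a)) ≤ Real.exp (-(z₀.re / 2 * φ a)) := by
      gcongr
    have h4 : z₀.re / 2 * φ a * Real.exp (-(z₀.re / 2 * φ a)) ≤ 1 := by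
      rw [Real.exp_neg, ← div_eq_mul_inv, div_le_one (Real.exp_pos _)]
      linarith [Real.add_one_le_exp (z₀.re / 2 * φ a)]
    rw [le_div_iff₀ hz₀']
    nlinarith [mul_le_mul_of_nonneg_right h3 h2]
  · refine Eventually.of_forall fun a z _ => ?_
    have h1 : HasDerivAt (fun z : ℂ => -z * (φ a : ℂ)) (-1 * φ a) z :=
      (hasDerivAt_neg z).mul_const _
    exact h1.cexp.const_mul _

lemma norm_integral_mul_exp_le [IsFiniteMeasure μ]
    (hg1 : ∀ᵐ a ∂μ, ‖g a‖ ≤ 1) (hφ0 : ∀ᵐ a ∂μ, 0 ≤ φ a) {z : ℂ} (hz : 0 ≤ z.re) :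
    ‖∫ a, g a * Complex.exp (-z * φ a) ∂μ‖ ≤ μ.real univ := by
  simpa using norm_integral_le_of_norm_le_const (norm_mul_exp_le_one hg1 hφ0 hz)

lemma eqOn_halfPlane {f h : ℂ → ℂ} (hf : DifferentiableOn ℂ f {z | 0 < z.re})
    (hh : DifferentiableOn ℂ h {z | 0 < z.re}) (heq : ∀ x : ℝ, 0 < x → f x = h x) :
    EqOn f h {z | 0 < z.re} := by
  have ho : IsOpen {z : ℂ | 0 < z.re} := isOpen_lt continuous_const Complex.continuous_re
  have hc : IsPreconnected {z : ℂ | 0 < z.re} := (convex_halfSpace_re_gt 0).isPreconnected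
  refine (hf.analyticOnNhd ho).eqOn_of_preconnected_of_frequently_eq (hh.analyticOnNhd ho) hc
    (z₀ := 1) (by simp) ?_
  have ht : Tendsto (fun x : ℝ => (x : ℂ)) (𝓝[>] 1) (𝓝[≠] 1) := by
    refine tendsto_nhdsWithin_iff.2 ⟨?_, ?_⟩
    · exact (Complex.continuous_ofReal.tendsto' 1 1 (by simp)).mono_left nhdsWithin_le_nhds
    · filter_upwards [self_mem_nhdsWithin] with x hx
      have : (1 : ℝ) < x := hx
      simpa using this.ne'
  refine ht.frequently (Eventually.frequently ?_)
  filter_upwards [self_mem_nhdsWithin] with x hx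
  exact heq x (zero_lt_one.trans hx)

/-- The complex Laplace transform of a measure on the line. -/
noncomputable def laplace (ν : Measure ℝ) (z : ℂ) : ℂ := ∫ u, 1 * Complex.exp (-z * u) ∂ν

/-- The complex Laplace transform of a measure on the plane. -/
noncomputable def laplace₂ (ρ : Measure (ℝ × ℝ)) (x y : ℂ) : ℂ :=
  ∫ p, Complex.exp (-x * p.1) * Complex.exp (-y * p.2) ∂ρ

lemma laplace_ofReal (ν : Measure ℝ) (x : ℝ) :
    laplace ν x = ((∫ u, Real.exp (-x * u) ∂ν : ℝ) : ℂ) := by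
  rw [laplace, ← integral_complex_ofReal]
  simp

lemma laplace₂_ofReal (ρ : Measure (ℝ × ℝ)) (x y : ℝ) :
    laplace₂ ρ x y = ((∫ p, Real.exp (-x * p.1 - y * p.2) ∂ρ : ℝ) : ℂ) := by
  rw [laplace₂, ← integral_complex_ofReal]
  congr 1
  funext p
  rw [← Complex.exp_add]
  push_cast
  ring_nf

lemma bar_complex {lam : ℝ} {pim : Measure (ℝ × ℝ)} [IsFiniteMeasure pim]
    (hpim : ∀ᵐ p ∂pim, 0 ≤ p.1 ∧ 0 ≤ p.2)
    {nu1 nu2 : Measure ℝ} [IsFiniteMeasure nu1] [IsFiniteMeasure nu2]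
    (hnu1 : ∀ᵐ u ∂nu1, 0 ≤ u) (hnu2 : ∀ᵐ u ∂nu2, 0 ≤ u)
    (hBAR : ∀ x ≥ (0:ℝ), ∀ y ≥ (0:ℝ),
      ((x - y) ^ 2 + lam * x + lam * y) * (∫ p, Real.exp (-x * p.1 - y * p.2) ∂pim)
        = (x - y / 2) * (∫ u, Real.exp (-y * u) ∂nu1)
          + (y - x / 2) * (∫ u, Real.exp (-x * u) ∂nu2))
    {x y : ℂ} (hx : 0 < x.re) (hy : 0 < y.re) :
    ((x - y) ^ 2 + lam * x + lam * y) * laplace₂ pim x y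
      = (x - y / 2) * laplace nu1 y + (y - x / 2) * laplace nu2 x := by
  have hd1 : DifferentiableOn ℂ (laplace nu1) {z | 0 < z.re} :=
    differentiableOn_integral_mul_exp measurable_const measurable_id (by simp) hnu1
  have hd2 : DifferentiableOn ℂ (laplace nu2) {z | 0 < z.re} :=
    differentiableOn_integral_mul_exp measurable_const measurable_id (by simp) hnu2
  have hdx : ∀ y : ℂ, 0 < y.re → DifferentiableOn ℂ (fun x => laplace₂ pim x y) {z | 0 < z.re} := by
    intro y hy
    have := differentiableOn_integral_mul_exp (μ := pim) (g := fun p => Complex.exp (-y * p.2))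
      (φ := Prod.fst) (by fun_prop) measurable_fst
      (hpim.mono fun p hp => norm_exp_neg_mul_le_one hy.le hp.2) (hpim.mono fun p hp => hp.1)
    refine this.congr fun z _ => ?_
    simp only [laplace₂, mul_comm]
  have hdy : ∀ x : ℂ, 0 < x.re → DifferentiableOn ℂ (fun y => laplace₂ pim x y) {z | 0 < z.re} := by
    intro x hx
    exact differentiableOn_integral_mul_exp (μ := pim) (g := fun p => Complex.exp (-x * p.1))
      (φ := Prod.snd) (by fun_prop) measurable_snd
      (hpim.mono fun p hp => norm_exp_neg_mul_le_one hx.le hp.1) (hpim.mono fun p hp => hp.2)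
  have hreal : ∀ y : ℝ, 0 < y → ∀ x : ℂ, 0 < x.re →
      ((x - y) ^ 2 + lam * x + lam * y) * laplace₂ pim x y
      = (x - y / 2) * laplace nu1 y + (y - x / 2) * laplace nu2 x := by
    intro y hy x hx
    have hy' : 0 < (y : ℂ).re := by simpa using hy
    have hdx := hdx y hy'
    refine eqOn_halfPlane (f := fun x : ℂ => ((x - y) ^ 2 + lam * x + lam * y) * laplace₂ pim x y)
      (h := fun x : ℂ => (x - y / 2) * laplace nu1 y + (y - x / 2) * laplace nu2 x)
      ?_ ?_ ?_ hx
    · exact DifferentiableOn.mul (by fun_prop) hdx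
    · exact DifferentiableOn.add (by fun_prop) (DifferentiableOn.mul (by fun_prop) hd2)
    · intro x hx
      simp only [laplace₂_ofReal, laplace_ofReal]
      exact_mod_cast hBAR x hx.le y hy.le
  refine eqOn_halfPlane (f := fun y : ℂ => ((x - y) ^ 2 + lam * x + lam * y) * laplace₂ pim x y)
      (h := fun y : ℂ => (x - y / 2) * laplace nu1 y + (y - x / 2) * laplace nu2 x)
      ?_ ?_ (fun y hy => hreal y hy x hx) hy
  · exact DifferentiableOn.mul (by fun_prop) (hdy x hx)
  · exact DifferentiableOn.add (DifferentiableOn.mul (by fun_prop) hd1) (by fun_prop)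

end HalfPlane

section Strip

open Filter Topology

lemma exp_I_mul_eq_one_of_im_eq_zero_on_edges {Q : ℂ → ℂ} {M : ℝ}
    (hd : DifferentiableOn ℂ Q {s | |s.re| < 1})
    (hM : ∀ s : ℂ, |s.re| ≤ 1 / 2 → ‖Q s‖ ≤ M)
    (hedge : ∀ s : ℂ, |s.re| = 1 / 2 → (Q s).im = 0)
    (hlim : Tendsto (fun t : ℝ => Q (t * Complex.I)) atTop (𝓝 0))
    {s : ℂ} (hs : |s.re| < 1 / 2) : Complex.exp (Complex.I * Q s) = 1 ∧ (Q s).im = 0 := by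
  have hnorm : ∀ c : ℝ, ∀ z, ‖Complex.exp (c * Complex.I * Q z)‖ = Real.exp (-c * (Q z).im) := by
    intro c z
    rw [Complex.norm_exp]
    congr 1
    simp [Complex.mul_re]
  have hpl : ∀ c : ℝ, |c| = 1 → ∀ z : ℂ, |z.re| ≤ 1 / 2 →
      ‖Complex.exp (c * Complex.I * Q z)‖ ≤ 1 := by
    intro c hc z hz
    have hcl : closure (Complex.re ⁻¹' Ioo (-1 / 2 : ℝ) (1 / 2)) ⊆ {s : ℂ | |s.re| < 1} := by
      have : closure (Complex.re ⁻¹' Ioo (-1 / 2 : ℝ) (1 / 2)) ⊆ Complex.re ⁻¹' Icc (-1 / 2) (1 / 2) :=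
        closure_minimal (preimage_mono Ioo_subset_Icc_self) (isClosed_Icc.preimage Complex.continuous_re)
      refine this.trans fun w hw => ?_
      have h1 : -1 / 2 ≤ w.re := hw.1
      have h2 : w.re ≤ 1 / 2 := hw.2
      have h : |w.re| < 1 := abs_lt.2 ⟨by linarith, by linarith⟩
      exact h
    refine PhragmenLindelof.vertical_strip (a := -1 / 2) (b := 1 / 2)
      (f := fun z => Complex.exp (c * Complex.I * Q z)) ?_ ⟨0, by positivity, M, ?_⟩ ?_ ?_ ?_ ?_
    · have : DifferentiableOn ℂ (fun z => Complex.exp (c * Complex.I * Q z)) {s | |s.re| < 1} := by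
        fun_prop
      exact (this.mono hcl).diffContOnCl
    · refine Asymptotics.IsBigO.of_bound 1 ?_
      filter_upwards [mem_inf_of_right (mem_principal_self _)] with w hw
      have hw' : |w.re| ≤ 1 / 2 := abs_le.2 ⟨by linarith [hw.1], by linarith [hw.2]⟩
      rw [hnorm, zero_mul, Real.exp_zero, mul_one, one_mul, Real.norm_of_nonneg (Real.exp_pos _).le]
      gcongr
      calc -c * (Q w).im ≤ |-c * (Q w).im| := le_abs_self _
        _ = |(Q w).im| := by rw [abs_mul, abs_neg, hc, one_mul]
        _ ≤ M := (Complex.abs_im_le_norm _).trans (hM w hw')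
    · intro w hw
      rw [hnorm, hedge w (by rw [hw]; norm_num)]
      simp
    · intro w hw
      rw [hnorm, hedge w (by rw [hw]; norm_num)]
      simp
    · linarith [(abs_le.1 hz).1]
    · exact (abs_le.1 hz).2
  have him : ∀ z : ℂ, |z.re| ≤ 1 / 2 → (Q z).im = 0 := by
    intro z hz
    have h1 := hpl 1 (by simp) z hz
    have h2 := hpl (-1) (by simp) z hz
    rw [hnorm, Real.exp_le_one_iff] at h1 h2
    linarith
  refine ⟨?_, him s hs.le⟩
  have hU : IsPreconnected {s : ℂ | |s.re| < 1 / 2} := by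
    have : {s : ℂ | |s.re| < 1 / 2} = {s : ℂ | -(1 / 2) < s.re} ∩ {s : ℂ | s.re < 1 / 2} := by
      ext z; simp [abs_lt]
    rw [this]
    exact ((convex_halfSpace_re_gt _).inter (convex_halfSpace_re_lt _)).isPreconnected
  have hUo : IsOpen {s : ℂ | |s.re| < 1 / 2} :=
    isOpen_lt (Complex.continuous_re.abs) continuous_const
  have hd' : DifferentiableOn ℂ (fun z => Complex.exp (Complex.I * Q z)) {s | |s.re| < 1 / 2} := by
    have := hd.mono (show {s : ℂ | |s.re| < 1 / 2} ⊆ {s | |s.re| < 1} from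
      fun z (hz : |z.re| < 1 / 2) => hz.trans (by norm_num))
    fun_prop
  have hone : ∀ z : ℂ, |z.re| ≤ 1 / 2 → ‖Complex.exp (Complex.I * Q z)‖ = 1 := by
    intro z hz
    have := hnorm 1 z
    rw [him z hz] at this
    simpa using this
  have hmax : IsMaxOn (norm ∘ fun z => Complex.exp (Complex.I * Q z)) {s | |s.re| < 1 / 2} s := by
    intro z hz
    have hz' : |z.re| < 1 / 2 := hz
    simp only [Function.comp, mem_ofPred_eq]
    rw [hone z hz'.le, hone s hs.le]
  have hconst := Complex.eqOn_of_isPreconnected_of_isMaxOn_norm hU hUo hd' hs hmax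
  have h1 : Tendsto (fun t : ℝ => Complex.exp (Complex.I * Q (t * Complex.I))) atTop (𝓝 1) := by
    have := ((hlim.const_mul Complex.I).cexp)
    simpa using this
  have h2 : (fun t : ℝ => Complex.exp (Complex.I * Q (t * Complex.I)))
      = fun _ => Complex.exp (Complex.I * Q s) := by
    funext t
    exact hconst (by simp)
  rw [h2] at h1
  exact tendsto_nhds_unique tendsto_const_nhds h1

lemma eq_zero_of_im_eq_zero_on_edges {Q : ℂ → ℂ} {M : ℝ}
    (hd : DifferentiableOn ℂ Q {s | |s.re| < 1})
    (hM : ∀ s : ℂ, |s.re| ≤ 1 / 2 → ‖Q s‖ ≤ M)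
    (hedge : ∀ s : ℂ, |s.re| = 1 / 2 → (Q s).im = 0)
    (hlim : Tendsto (fun t : ℝ => Q (t * Complex.I)) atTop (𝓝 0))
    {s : ℂ} (hs : |s.re| < 1) : Q s = 0 := by
  have hsmall : ∀ z : ℂ, |z.re| < 1 / 2 → Q z = 0 := by
    intro z hz
    have him := (exp_I_mul_eq_one_of_im_eq_zero_on_edges hd hM hedge hlim hz).2
    by_contra hne
    have hre : (Q z).re ≠ 0 := fun h => hne (Complex.ext h him)
    have hq : Q z = ((Q z).re : ℂ) := Complex.ext (by simp) (by simp [him])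
    set c : ℝ := Real.pi / (Q z).re
    have h := (exp_I_mul_eq_one_of_im_eq_zero_on_edges (Q := fun z => c * Q z) (M := |c| * M)
      (by fun_prop) (fun s hs => by
        rw [norm_mul, Complex.norm_real, Real.norm_eq_abs]
        exact mul_le_mul_of_nonneg_left (hM s hs) (abs_nonneg _))
      (fun s hs => by simp [hedge s hs]) (by simpa using hlim.const_mul (c : ℂ)) hz).1
    have e : Complex.I * (c * Q z) = Real.pi * Complex.I := by
      rw [hq, ← Complex.ofReal_mul, div_mul_cancel₀ _ hre, mul_comm]
    simp only [e, Complex.exp_pi_mul_I] at h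
    norm_num at h
  have ho : IsOpen {s : ℂ | |s.re| < 1} := isOpen_lt (Complex.continuous_re.abs) continuous_const
  have hU : IsPreconnected {s : ℂ | |s.re| < 1} := by
    have : {s : ℂ | |s.re| < 1} = {s : ℂ | -1 < s.re} ∩ {s : ℂ | s.re < 1} := by
      ext z; simp [abs_lt]
    rw [this]
    exact ((convex_halfSpace_re_gt _).inter (convex_halfSpace_re_lt _)).isPreconnected
  refine (hd.analyticOnNhd ho).eqOn_zero_of_preconnected_of_eventuallyEq_zero hU (z₀ := 0)
    (by simp) ?_ hs
  have : {s : ℂ | |s.re| < 1 / 2} ∈ 𝓝 (0 : ℂ) :=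
    (isOpen_lt (Complex.continuous_re.abs) continuous_const).mem_nhds (by simp)
  filter_upwards [this] with z hz using hsmall z hz

end Strip

section Glue

open Filter Topology

/-- The properties of the Laplace transform of a finite measure on the half-line. -/
structure LaplaceLike (n : ℂ → ℂ) (M : ℝ) : Prop where
  diff : DifferentiableOn ℂ n {z | 0 < z.re}
  cont : ContinuousOn n {z | 0 ≤ z.re}
  bound : ∀ z : ℂ, 0 ≤ z.re → ‖n z‖ ≤ M
  real : ∀ x : ℝ, 0 ≤ x → (n x).im = 0

/-- First coordinate of the parametrised parabola `(x - y)² + x + y = 0`; the second coordinate is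
`parabolaX (-s)`. -/
noncomputable def parabolaX (s : ℂ) : ℂ := s * (1 - s) / 2

lemma parabolaX_re (s : ℂ) : (parabolaX s).re = (s.re - s.re ^ 2 + s.im ^ 2) / 2 := by
  have : parabolaX s = ((1 / 2 : ℝ) : ℂ) * (s * (1 - s)) := by
    unfold parabolaX; push_cast; ring
  rw [this, Complex.re_ofReal_mul]
  simp [Complex.mul_re]
  ring

lemma continuous_parabolaX : Continuous parabolaX := by unfold parabolaX; fun_prop

lemma differentiable_parabolaX : Differentiable ℂ parabolaX := by unfold parabolaX; fun_prop

/-- The common continuation of `n₂ (x(s)) / (3 - s)` and `n₁ (y(s)) / (3 + s)` to a strip. -/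
noncomputable def glued (n₁ n₂ : ℂ → ℂ) (s : ℂ) : ℂ :=
  if 0 ≤ s.re then n₂ (parabolaX s) / (3 - s) else n₁ (parabolaX (-s)) / (3 + s)

lemma three_sub_ne_zero {s : ℂ} (hs : |s.re| < 1) : 3 - s ≠ 0 := fun h => by
  have := congrArg Complex.re h
  simp at this
  linarith [(abs_lt.1 hs).2]

lemma three_add_ne_zero {s : ℂ} (hs : |s.re| < 1) : 3 + s ≠ 0 := by
  have := three_sub_ne_zero (s := -s) (by simpa using hs)
  simpa using this

lemma isOpen_strip : IsOpen {s : ℂ | |s.re| < 1} :=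
  isOpen_lt (Complex.continuous_re.abs) continuous_const

variable {n₁ n₂ : ℂ → ℂ} {M : ℝ}

lemma LaplaceLike.differentiableAt_comp {n : ℂ → ℂ} (h : LaplaceLike n M) {s : ℂ}
    (hs : |s.re| < 1) (hx : 0 < (parabolaX s).re) :
    DifferentiableAt ℂ (fun s => n (parabolaX s) / (3 - s)) s := by
  have h1 : DifferentiableAt ℂ n (parabolaX s) := h.diff.differentiableAt
    ((isOpen_lt continuous_const Complex.continuous_re).mem_nhds hx)
  exact (h1.comp s differentiable_parabolaX.differentiableAt).div (by fun_prop) (three_sub_ne_zero hs)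

lemma LaplaceLike.continuousWithinAt_comp {n : ℂ → ℂ} (h : LaplaceLike n M) :
    ContinuousWithinAt (fun s => n (parabolaX s) / (3 - s)) {s | 0 ≤ s.re ∧ s.re < 1} 0 := by
  have h1 : ContinuousOn (fun s => n (parabolaX s)) {s | 0 ≤ s.re ∧ s.re < 1} := by
    refine h.cont.comp continuous_parabolaX.continuousOn fun s hs => ?_
    obtain ⟨ha, hb⟩ : 0 ≤ s.re ∧ s.re < 1 := hs
    have : 0 ≤ (parabolaX s).re := by rw [parabolaX_re]; nlinarith [sq_nonneg s.im]
    exact this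
  exact (h1 0 (by simp)).div (by fun_prop) (by norm_num)

lemma differentiableOn_glued (h₁ : LaplaceLike n₁ M) (h₂ : LaplaceLike n₂ M)
    (h0 : n₁ 0 = n₂ 0)
    (hrel : ∀ s : ℂ, s ≠ 0 → 0 < (parabolaX s).re → 0 < (parabolaX (-s)).re →
      (3 - s) * n₁ (parabolaX (-s)) = (3 + s) * n₂ (parabolaX s)) :
    DifferentiableOn ℂ (glued n₁ n₂) {s | |s.re| < 1} := by
  refine (Complex.differentiableOn_compl_singleton_and_continuousAt_iff
    (isOpen_strip.mem_nhds (by simp : |(0 : ℂ).re| < 1))).1 ⟨?_, ?_⟩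
  · rintro s ⟨hs, hs0⟩
    have hs' : |s.re| < 1 := hs
    have hs0' : s ≠ 0 := hs0
    refine DifferentiableAt.differentiableWithinAt ?_
    have hneg : |(-s).re| < 1 := by simpa using hs'
    rcases lt_trichotomy s.re 0 with hlt | heq | hgt
    · have hx : 0 < (parabolaX (-s)).re := by
        rw [parabolaX_re]
        simp only [Complex.neg_re, Complex.neg_im]
        nlinarith [sq_nonneg s.im, (abs_lt.1 hs').1]
      have hd := (h₁.differentiableAt_comp hneg hx).comp s differentiable_neg.differentiableAt
      refine hd.congr_of_eventuallyEq ?_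
      filter_upwards [(isOpen_lt Complex.continuous_re continuous_const).mem_nhds hlt] with z hz
      have hz' : z.re < 0 := hz
      simp [glued, not_le.2 hz']
    · have him : s.im ≠ 0 := fun h => hs0' (Complex.ext heq h)
      have hx : 0 < (parabolaX s).re := by rw [parabolaX_re, heq]; positivity
      have hy : 0 < (parabolaX (-s)).re := by
        rw [parabolaX_re, Complex.neg_re, Complex.neg_im, heq]
        have := sq_pos_of_ne_zero him
        nlinarith
      refine (h₂.differentiableAt_comp hs' hx).congr_of_eventuallyEq ?_
      filter_upwards [(isOpen_lt continuous_const
          (Complex.continuous_re.comp continuous_parabolaX)).mem_nhds hx,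
        (isOpen_lt continuous_const (Complex.continuous_re.comp
          (continuous_parabolaX.comp continuous_neg))).mem_nhds hy,
        isOpen_strip.mem_nhds hs, isOpen_ne.mem_nhds hs0'] with z hzx hzy hzs hz0
      unfold glued
      split_ifs
      · rfl
      · have a1 := three_sub_ne_zero hzs
        have a2 := three_add_ne_zero hzs
        rw [div_eq_div_iff a2 a1]
        linear_combination hrel z hz0 hzx hzy
    · have hx : 0 < (parabolaX s).re := by
        rw [parabolaX_re]
        nlinarith [sq_nonneg s.im, (abs_lt.1 hs').2]
      refine (h₂.differentiableAt_comp hs' hx).congr_of_eventuallyEq ?_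
      filter_upwards [(isOpen_lt continuous_const Complex.continuous_re).mem_nhds hgt] with z hz
      have hz' : 0 < z.re := hz
      simp [glued, hz'.le]
  · have hp : ContinuousWithinAt (glued n₁ n₂) {s | 0 ≤ s.re ∧ s.re < 1} 0 := by
      refine h₂.continuousWithinAt_comp.congr (fun s hs => ?_) ?_
      · have : 0 ≤ s.re := hs.1
        simp [glued, this]
      · simp [glued]
    have hm : ContinuousWithinAt (glued n₁ n₂) {s | -1 < s.re ∧ s.re < 0} 0 := by
      have h := h₁.continuousWithinAt_comp
      have h' : ContinuousWithinAt (fun s => n₁ (parabolaX (-s)) / (3 - -s))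
          {s | -1 < s.re ∧ s.re < 0} 0 := by
        refine ContinuousWithinAt.comp (g := fun s => n₁ (parabolaX s) / (3 - s))
          (t := {s | 0 ≤ s.re ∧ s.re < 1}) (by simpa using h) continuous_neg.continuousWithinAt
          fun s hs => ?_
        obtain ⟨ha, hb⟩ : -1 < s.re ∧ s.re < 0 := hs
        have : 0 ≤ (-s).re ∧ (-s).re < 1 := by
          rw [Complex.neg_re]; constructor <;> linarith
        exact this
      refine h'.congr (fun s hs => ?_) ?_
      · have : s.re < 0 := hs.2
        simp [glued, not_le.2 this]
      · simp [glued, parabolaX, h0]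
    refine (hp.union hm).continuousAt ?_
    filter_upwards [isOpen_strip.mem_nhds (by simp : |(0 : ℂ).re| < 1)] with s hs
    obtain ⟨ha, hb⟩ := abs_lt.1 hs
    rcases le_or_gt 0 s.re with h | h
    · exact Or.inl ⟨h, hb⟩
    · exact Or.inr ⟨ha, h⟩

lemma norm_glued_le (h₁ : LaplaceLike n₁ M) (h₂ : LaplaceLike n₂ M) {s : ℂ} (hs : |s.re| < 1) :
    ‖glued n₁ n₂ s‖ ≤ M := by
  obtain ⟨ha, hb⟩ := abs_lt.1 hs
  have aux : ∀ {n : ℂ → ℂ} (_ : LaplaceLike n M) {z : ℂ}, 0 ≤ z.re → z.re < 1 →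
      ‖n (parabolaX z) / (3 - z)‖ ≤ M := by
    intro n h z hz0 hz1
    have h1 : 1 ≤ ‖3 - z‖ := by
      refine le_trans ?_ (Complex.re_le_norm _)
      simp
      linarith
    have h2 : ‖n (parabolaX z)‖ ≤ M :=
      h.bound _ (by rw [parabolaX_re]; nlinarith [sq_nonneg z.im])
    rw [norm_div]
    exact (div_le_self (norm_nonneg _) h1).trans h2
  unfold glued
  split_ifs with h
  · exact aux h₂ h hb
  · have := aux h₁ (z := -s) (by simp; linarith) (by simp; linarith)
    simpa using this

end Glue

section Identify

open Filter Topology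

lemma abs_im_le_norm_sin_pi (s : ℂ) : |s.im| ≤ ‖Complex.sin (Real.pi * s)‖ := by
  have h1 : |Real.sinh (Real.pi * s.im)| ≤ ‖Complex.sin (Real.pi * s)‖ := by
    have h := abs_norm_sub_norm_le (Complex.exp (-(Real.pi * s) * Complex.I))
      (Complex.exp (Real.pi * s * Complex.I))
    rw [Complex.norm_exp, Complex.norm_exp] at h
    simp only [Complex.mul_re, Complex.mul_im, Complex.neg_re, Complex.neg_im, Complex.I_re,
      Complex.I_im, Complex.ofReal_re, Complex.ofReal_im, mul_zero, mul_one, zero_mul, zero_sub,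
      add_zero, neg_neg, sub_zero] at h
    rw [Complex.sin, norm_div, norm_mul, Complex.norm_I, mul_one, Real.sinh_eq, abs_div]
    simpa using div_le_div_of_nonneg_right h (by norm_num : (0 : ℝ) ≤ 2)
  refine le_trans ?_ h1
  rw [Real.abs_sinh, abs_mul, abs_of_pos Real.pi_pos]
  have h2 : |s.im| ≤ Real.pi * |s.im| := by nlinarith [Real.pi_gt_three, abs_nonneg s.im]
  exact h2.trans (Real.self_le_sinh_iff.2 (by positivity))

lemma sin_pi_mul_ne_zero_of_strip {s : ℂ} (hs : |s.re| < 1) (h0 : s ≠ 0) :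
    Complex.sin (Real.pi * s) ≠ 0 := by
  intro h
  obtain ⟨k, hk⟩ := Complex.sin_eq_zero_iff.1 h
  have hpi : (Real.pi : ℂ) ≠ 0 := by exact_mod_cast Real.pi_ne_zero
  have hsk : s = k := by
    apply mul_left_cancel₀ hpi
    rw [hk]; ring
  rw [hsk] at hs h0
  have h1 : |(k : ℝ)| < 1 := by simpa using hs
  have h2 : |k| < 1 := by exact_mod_cast h1
  rw [Int.abs_lt_one_iff] at h2
  simp [h2] at h0

/-- The entire function `sin (π s) / s`. -/
noncomputable def sinPiDiv : ℂ → ℂ := dslope (fun s => Complex.sin (Real.pi * s)) 0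

lemma sinPiDiv_of_ne {s : ℂ} (h0 : s ≠ 0) : sinPiDiv s = Complex.sin (Real.pi * s) / s := by
  rw [sinPiDiv, dslope_of_ne _ h0, slope_def_field]
  simp

lemma sinPiDiv_zero : sinPiDiv 0 = Real.pi := by
  rw [sinPiDiv, dslope_same]
  have h : HasDerivAt (fun s : ℂ => Complex.sin (Real.pi * s)) (Real.pi : ℂ) 0 := by
    have := ((hasDerivAt_id (0 : ℂ)).const_mul (Real.pi : ℂ)).csin
    simpa using this
  exact h.deriv

lemma sinPiDiv_ne_zero {s : ℂ} (hs : |s.re| < 1) : sinPiDiv s ≠ 0 := by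
  rcases eq_or_ne s 0 with rfl | h0
  · rw [sinPiDiv_zero]; exact_mod_cast Real.pi_ne_zero
  · rw [sinPiDiv_of_ne h0]
    exact div_ne_zero (sin_pi_mul_ne_zero_of_strip hs h0) h0

lemma differentiableOn_sinPiDiv : DifferentiableOn ℂ sinPiDiv {s | |s.re| < 1} := by
  refine (Complex.differentiableOn_dslope (isOpen_strip.mem_nhds (by simp))).2 ?_
  have : Differentiable ℂ (fun s : ℂ => Complex.sin (Real.pi * s)) := by fun_prop
  exact this.differentiableOn

/-- The quartic `(s² - 1)(s² - 4)`. -/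
noncomputable def quartic (s : ℂ) : ℂ := (s ^ 2 - 1) * (s ^ 2 - 4)

lemma one_le_norm_quartic {s : ℂ} (hs : |s.re| ≤ 1) (hi : 1 ≤ |s.im|) : 1 ≤ ‖quartic s‖ := by
  have h1 : 1 ≤ s.im ^ 2 := by nlinarith [sq_abs s.im]
  have h2 : s.re ^ 2 ≤ 1 := by nlinarith [sq_abs s.re, abs_nonneg s.re]
  have h3 : 1 ≤ ‖s ^ 2 - 1‖ := by
    refine le_trans ?_ ((neg_le_abs _).trans (Complex.abs_re_le_norm _))
    simp [sq]
    nlinarith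
  have h4 : 1 ≤ ‖s ^ 2 - 4‖ := by
    refine le_trans ?_ ((neg_le_abs _).trans (Complex.abs_re_le_norm _))
    simp [sq]
    nlinarith
  rw [quartic, norm_mul]
  nlinarith

lemma quartic_ne_zero {s : ℂ} (hs : |s.re| < 1) : quartic s ≠ 0 := by
  have aux : ∀ a : ℝ, 1 ≤ |a| → s - a ≠ 0 := by
    intro a ha h
    have : s = a := sub_eq_zero.1 h
    rw [this, Complex.ofReal_re] at hs
    linarith
  have h1 := aux 1 (by norm_num)
  have h2 := aux (-1) (by norm_num)
  have h3 := aux 2 (by norm_num)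
  have h4 := aux (-2) (by norm_num)
  have : quartic s = (s - (1 : ℝ)) * (s - (-1 : ℝ)) * ((s - (2 : ℝ)) * (s - (-2 : ℝ))) := by
    unfold quartic; push_cast; ring
  rw [this]
  exact mul_ne_zero (mul_ne_zero h1 h2) (mul_ne_zero h3 h4)

/-- The numerator `H(s) sin(πs)/s - C (s²-1)(s²-4)`. -/
noncomputable def defectNum (H : ℂ → ℂ) (C : ℂ) (s : ℂ) : ℂ := H s * sinPiDiv s - C * quartic s

/-- The function `H(s)/(s(s²-1)(s²-4)) - C/sin(πs)`, with its singularity at the origin removed. -/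
noncomputable def defect (H : ℂ → ℂ) (C : ℂ) (s : ℂ) : ℂ :=
  dslope (defectNum H C) 0 s / (sinPiDiv s * quartic s)

variable {H : ℂ → ℂ} {C : ℂ} {M : ℝ}

lemma differentiableOn_defect (hH : DifferentiableOn ℂ H {s | |s.re| < 1}) :
    DifferentiableOn ℂ (defect H C) {s | |s.re| < 1} := by
  have hq : Differentiable ℂ quartic := by unfold quartic; fun_prop
  have hD : DifferentiableOn ℂ (defectNum H C) {s | |s.re| < 1} :=
    (hH.mul differentiableOn_sinPiDiv).sub (hq.differentiableOn.const_mul C)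
  refine ((Complex.differentiableOn_dslope (isOpen_strip.mem_nhds (by simp))).2 hD).div
    (differentiableOn_sinPiDiv.mul hq.differentiableOn) fun s hs => ?_
  exact mul_ne_zero (sinPiDiv_ne_zero hs) (quartic_ne_zero hs)

lemma defect_of_ne (h0 : H 0 * Real.pi = 4 * C) {s : ℂ} (hs : |s.re| < 1) (hs0 : s ≠ 0) :
    defect H C s = H s / (s * quartic s) - C / Complex.sin (Real.pi * s) := by
  have h1 : defectNum H C 0 = 0 := by
    rw [defectNum, sinPiDiv_zero, h0]; unfold quartic; ring
  have h2 := sin_pi_mul_ne_zero_of_strip hs hs0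
  have h3 := quartic_ne_zero hs
  rw [defect, dslope_of_ne _ hs0, slope_def_field, h1, defectNum, sinPiDiv_of_ne hs0]
  field_simp
  ring

lemma norm_defect_le (h0 : H 0 * Real.pi = 4 * C) (hM : ∀ s : ℂ, |s.re| < 1 → ‖H s‖ ≤ M)
    {s : ℂ} (hs : |s.re| < 1) (hi : 1 ≤ |s.im|) : ‖defect H C s‖ ≤ (M + ‖C‖) / |s.im| := by
  have hs0 : s ≠ 0 := by rintro rfl; norm_num at hi
  rw [defect_of_ne h0 hs hs0, add_div]
  have hpos : 0 < |s.im| := by linarith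
  refine (norm_sub_le _ _).trans (add_le_add ?_ ?_)
  · rw [norm_div, norm_mul]
    have h1 := one_le_norm_quartic hs.le hi
    have h2 := Complex.abs_im_le_norm s
    have h3 : |s.im| ≤ ‖s‖ * ‖quartic s‖ := by nlinarith [norm_nonneg s]
    exact div_le_div₀ ((norm_nonneg _).trans (hM s hs)) (hM s hs) hpos h3
  · rw [norm_div]
    exact div_le_div_of_nonneg_left (norm_nonneg _) hpos (abs_im_le_norm_sin_pi s)

lemma defect_eq_zero (hH : DifferentiableOn ℂ H {s | |s.re| < 1}) (h0 : H 0 * Real.pi = 4 * C)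
    (hM : ∀ s : ℂ, |s.re| < 1 → ‖H s‖ ≤ M)
    (hedge : ∀ s : ℂ, |s.re| = 1 / 2 →
      (H s / (s * quartic s) - C / Complex.sin (Real.pi * s)).im = 0)
    {s : ℂ} (hs : |s.re| < 1) : defect H C s = 0 := by
  have hd := differentiableOn_defect (C := C) hH
  have hM0 : 0 ≤ M := (norm_nonneg _).trans (hM 0 (by simp))
  obtain ⟨K, hK⟩ : ∃ K, ∀ z ∈ Icc (-1 / 2 : ℝ) (1 / 2) ×ℂ Icc (-1 : ℝ) 1, ‖defect H C z‖ ≤ K := by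
    refine (isCompact_Icc.reProdIm isCompact_Icc).exists_bound_of_continuousOn
      (hd.continuousOn.mono fun z hz => ?_)
    have h1 := (Complex.mem_reProdIm.1 hz).1
    have : |z.re| < 1 := abs_lt.2 ⟨by linarith [h1.1], by linarith [h1.2]⟩
    exact this
  refine eq_zero_of_im_eq_zero_on_edges (M := max K (M + ‖C‖)) hd (fun z hz => ?_)
    (fun z hz => ?_) ?_ hs
  · rcases le_total |z.im| 1 with h | h
    · refine (hK z (Complex.mem_reProdIm.2 ⟨?_, ?_⟩)).trans (le_max_left _ _)
      · have := abs_le.1 hz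
        exact ⟨by linarith [this.1], by linarith [this.2]⟩
      · exact abs_le.1 h
    · refine (norm_defect_le h0 hM (by linarith) h).trans ((div_le_self ?_ h).trans
        (le_max_right _ _))
      positivity
  · have hz0 : z ≠ 0 := by rintro rfl; norm_num at hz
    rw [defect_of_ne h0 (by rw [hz]; norm_num) hz0]
    exact hedge z hz
  · refine squeeze_zero_norm' (a := fun t : ℝ => (M + ‖C‖) / t) ?_
      (tendsto_const_nhds.div_atTop tendsto_id)
    filter_upwards [eventually_ge_atTop 1] with t ht
    have := norm_defect_le (s := t * Complex.I) h0 hM (by simp)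
      (by simpa using ht.trans (le_abs_self t))
    simpa [abs_of_pos (show 0 < t by linarith)] using this

lemma im_div_eq_zero {z w : ℂ} (hz : z.im = 0) (hw : w.im = 0) : (z / w).im = 0 := by
  simp [Complex.div_im, hz, hw]

lemma parabolaX_edge (t : ℝ) :
    parabolaX (1 / 2 + t * Complex.I) = ((1 / 8 + t ^ 2 / 2 : ℝ) : ℂ) := by
  unfold parabolaX
  push_cast
  linear_combination -(t : ℂ) ^ 2 / 2 * Complex.I_sq

lemma sin_pi_edge (t : ℝ) :
    Complex.sin (Real.pi * (1 / 2 + t * Complex.I)) = ((Real.cosh (Real.pi * t) : ℝ) : ℂ) := by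
  have : (Real.pi * (1 / 2 + t * Complex.I) : ℂ)
      = ((Real.pi * t : ℝ) : ℂ) * Complex.I + Real.pi / 2 := by
    push_cast; ring
  rw [this, Complex.sin_add_pi_div_two, Complex.cos_mul_I, Complex.ofReal_cosh]

/-- The cubic `8 X (X + 1) (X + 3)`. -/
noncomputable def cubic (X : ℝ) : ℝ := 8 * X * (X + 1) * (X + 3)

lemma edge_eq (n : ℂ → ℂ) (t : ℝ) (C : ℂ) {s : ℂ} (hs : s = 1 / 2 + t * Complex.I) :
    n (parabolaX s) / (3 - s) / (s * quartic s) - C / Complex.sin (Real.pi * s)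
      = n ((1 / 8 + t ^ 2 / 2 : ℝ) : ℂ) / ((cubic (1 / 8 + t ^ 2 / 2) : ℝ) : ℂ)
        - C / ((Real.cosh (Real.pi * t) : ℝ) : ℂ) := by
  have h : (3 - s) * (s * quartic s) = ((cubic (1 / 8 + t ^ 2 / 2) : ℝ) : ℂ) := by
    have h1 := parabolaX_edge t
    have h2 : (3 - s) * (s * quartic s)
        = 8 * parabolaX s * (parabolaX s + 1) * (parabolaX s + 3) := by
      unfold quartic parabolaX; ring
    rw [h2, hs, h1]
    unfold cubic
    push_cast
    ring
  rw [div_div, h, hs, parabolaX_edge, sin_pi_edge]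

lemma LaplaceLike.im_edge_eq_zero {n : ℂ → ℂ} (h : LaplaceLike n M) (hC : C.im = 0) (t : ℝ) :
    (n ((1 / 8 + t ^ 2 / 2 : ℝ) : ℂ) / ((cubic (1 / 8 + t ^ 2 / 2) : ℝ) : ℂ)
        - C / ((Real.cosh (Real.pi * t) : ℝ) : ℂ)).im = 0 := by
  rw [Complex.sub_im, im_div_eq_zero (h.real _ (by positivity)) (Complex.ofReal_im _),
    im_div_eq_zero hC (Complex.ofReal_im _), sub_zero]

lemma eq_half_add_of_re {s : ℂ} (hs : s.re = 1 / 2) : s = 1 / 2 + s.im * Complex.I := by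
  have := (Complex.re_add_im s).symm
  rwa [hs, Complex.ofReal_div, Complex.ofReal_one, Complex.ofReal_ofNat] at this

variable {n₁ n₂ : ℂ → ℂ}

lemma glued_edge_right (t : ℝ) {s : ℂ} (hs : s = 1 / 2 + t * Complex.I) :
    glued n₁ n₂ s / (s * quartic s) - C / Complex.sin (Real.pi * s)
      = n₂ ((1 / 8 + t ^ 2 / 2 : ℝ) : ℂ) / ((cubic (1 / 8 + t ^ 2 / 2) : ℝ) : ℂ)
        - C / ((Real.cosh (Real.pi * t) : ℝ) : ℂ) := by
  rw [← edge_eq n₂ t C hs]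
  have : 0 ≤ s.re := by rw [hs]; simp
  simp [glued, this]

lemma glued_edge_left (t : ℝ) {s : ℂ} (hs : -s = 1 / 2 + t * Complex.I) :
    glued n₁ n₂ s / (s * quartic s) - C / Complex.sin (Real.pi * s)
      = -(n₁ ((1 / 8 + t ^ 2 / 2 : ℝ) : ℂ) / ((cubic (1 / 8 + t ^ 2 / 2) : ℝ) : ℂ)
        - C / ((Real.cosh (Real.pi * t) : ℝ) : ℂ)) := by
  rw [← edge_eq n₁ t C hs]
  have hlt : ¬ 0 ≤ s.re := by
    have := congrArg Complex.re hs
    simp at this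
    linarith
  have hq : quartic (-s) = quartic s := by unfold quartic; ring
  rw [glued, if_neg hlt, hq, mul_neg, Complex.sin_neg, sub_neg_eq_add, neg_mul, div_neg, div_neg]
  ring

lemma cubic_pos {X : ℝ} (hX : 0 < X) : 0 < cubic X := by unfold cubic; positivity

/-- Identification of both boundary transforms from the relation on the parabola. -/
theorem LaplaceLike.eq_sechSum {κ : ℝ} (h₁ : LaplaceLike n₁ M) (h₂ : LaplaceLike n₂ M)
    (h1κ : n₁ 0 = κ) (h2κ : n₂ 0 = κ)
    (hrel : ∀ s : ℂ, s ≠ 0 → 0 < (parabolaX s).re → 0 < (parabolaX (-s)).re →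
      (3 - s) * n₁ (parabolaX (-s)) = (3 + s) * n₂ (parabolaX s)) {X : ℝ} (hX : 1 ≤ X) :
    n₁ X = ((κ / 3 * (X * (X + 1) * (X + 3)) * sechSum X : ℝ) : ℂ) ∧
      n₂ X = ((κ / 3 * (X * (X + 1) * (X + 3)) * sechSum X : ℝ) : ℂ) := by
  set C : ℂ := ((Real.pi * κ / 12 : ℝ) : ℂ) with hC
  have h0 : glued n₁ n₂ 0 * Real.pi = 4 * C := by
    simp [glued, parabolaX, h2κ, hC]
    ring
  have hCim : C.im = 0 := Complex.ofReal_im _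
  have hz : ∀ {s : ℂ}, |s.re| < 1 → defect (glued n₁ n₂) C s = 0 := by
    intro s hs
    refine defect_eq_zero (differentiableOn_glued h₁ h₂ (h1κ.trans h2κ.symm) hrel) h0
      (fun s hs => norm_glued_le h₁ h₂ hs) (fun s hs => ?_) hs
    rcases (abs_eq (by norm_num)).1 hs with h | h
    · rw [glued_edge_right s.im (eq_half_add_of_re h)]
      exact h₂.im_edge_eq_zero hCim _
    · rw [glued_edge_left (-s).im (eq_half_add_of_re (s := -s) (by simp [h])), Complex.neg_im,
        h₁.im_edge_eq_zero hCim, neg_zero]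
  obtain ⟨t, ht, htX⟩ : ∃ t : ℝ, t = Real.sqrt (2 * X - 1 / 4) ∧ 1 / 8 + t ^ 2 / 2 = X := by
    refine ⟨_, rfl, ?_⟩
    rw [Real.sq_sqrt (by linarith)]; ring
  have key : ∀ {z : ℂ}, z / ((cubic X : ℝ) : ℂ) - C / ((Real.cosh (Real.pi * t) : ℝ) : ℂ) = 0 →
      z = ((κ / 3 * (X * (X + 1) * (X + 3)) * sechSum X : ℝ) : ℂ) := by
    intro z h
    have hc : ((cubic X : ℝ) : ℂ) ≠ 0 := by exact_mod_cast (cubic_pos (by linarith)).ne'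
    rw [sub_eq_zero, div_eq_iff hc] at h
    rw [h, hC, ← Complex.ofReal_div, ← Complex.ofReal_mul]
    congr 1
    rw [sechSum, ← ht, cubic]
    have := (Real.cosh_pos (Real.pi * t)).ne'
    field_simp
    ring
  constructor
  · set s : ℂ := -(1 / 2 + t * Complex.I) with hs
    have hre : |s.re| < 1 := by rw [hs]; simp; norm_num
    have hs0 : s ≠ 0 := fun h => by
      have := congrArg Complex.re h
      simp [hs] at this
    have h := defect_of_ne h0 hre hs0
    rw [hz hre, glued_edge_left t (by rw [hs, neg_neg]), htX] at h
    exact key (neg_eq_zero.1 h.symm)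
  · set s : ℂ := 1 / 2 + t * Complex.I with hs
    have hre : |s.re| < 1 := by rw [hs]; simp; norm_num
    have hs0 : s ≠ 0 := fun h => by
      have := congrArg Complex.re h
      simp [hs] at this
    have h := defect_of_ne h0 hre hs0
    rw [hz hre, glued_edge_right t hs, htX] at h
    exact key h.symm

end Identify

section Apply

open Filter Topology

lemma tendsto_integral_exp_neg_mul {α : Type*} [MeasurableSpace α] {μ : Measure α}
    [IsFiniteMeasure μ] {φ : α → ℝ} (hφ : Measurable φ) (hφ0 : ∀ᵐ a ∂μ, 0 ≤ φ a) :
    Tendsto (fun x : ℝ => ∫ a, Real.exp (-x * φ a) ∂μ) (𝓝[>] 0) (𝓝 (μ.real univ)) := by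
  have h : Tendsto (fun x : ℝ => ∫ a, Real.exp (-x * φ a) ∂μ) (𝓝[>] 0) (𝓝 (∫ _, (1 : ℝ) ∂μ)) := by
    refine tendsto_integral_filter_of_dominated_convergence (fun _ => 1)
      (Eventually.of_forall fun x => ?_) ?_ (integrable_const _) (Eventually.of_forall fun a => ?_)
    · have : Measurable (fun a => Real.exp (-x * φ a)) := by fun_prop
      exact this.aestronglyMeasurable
    · filter_upwards [self_mem_nhdsWithin] with x hx
      filter_upwards [hφ0] with a ha
      have hx' : 0 < x := hx
      rw [Real.norm_eq_abs, Real.abs_exp, Real.exp_le_one_iff]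
      nlinarith [mul_nonneg hx'.le ha]
    · have : Continuous fun x : ℝ => Real.exp (-x * φ a) := by fun_prop
      exact (this.tendsto' 0 1 (by simp)).mono_left nhdsWithin_le_nhds
  simpa using h

lemma LaplaceLike.laplace_mul {ν : Measure ℝ} [IsFiniteMeasure ν] (hν : ∀ᵐ u ∂ν, 0 ≤ u)
    {lam : ℝ} (hlam : 0 < lam) {M : ℝ} (hM : ν.real univ ≤ M) :
    LaplaceLike (fun z => laplace ν (lam * z)) M where
  diff := by
    refine (differentiableOn_integral_mul_exp (μ := ν) (g := fun _ => 1) (φ := id)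
      measurable_const measurable_id (by simp) hν).comp
      (by fun_prop : Differentiable ℂ fun z : ℂ => lam * z).differentiableOn fun z hz => ?_
    have h : 0 < ((lam : ℂ) * z).re := by
      rw [Complex.re_ofReal_mul]; exact mul_pos hlam hz
    exact h
  cont := by
    refine (continuousOn_integral_mul_exp (μ := ν) (g := fun _ => 1) (φ := id)
      measurable_const measurable_id (by simp) hν).comp
      (by fun_prop : Continuous fun z : ℂ => lam * z).continuousOn fun z hz => ?_
    have h : 0 ≤ ((lam : ℂ) * z).re := by
      rw [Complex.re_ofReal_mul]; exact mul_nonneg hlam.le hz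
    exact h
  bound z hz := by
    refine (norm_integral_mul_exp_le (μ := ν) (g := fun _ => 1) (φ := id) (by simp) hν ?_).trans hM
    rw [Complex.re_ofReal_mul]; exact mul_nonneg hlam.le hz
  real x _ := by
    rw [← Complex.ofReal_mul, laplace_ofReal]
    exact Complex.ofReal_im _

variable {lam : ℝ} {pim : Measure (ℝ × ℝ)} {nu1 nu2 : Measure ℝ}

lemma bar_masses [IsProbabilityMeasure pim] (hpim : ∀ᵐ p ∂pim, 0 ≤ p.1 ∧ 0 ≤ p.2)
    [IsFiniteMeasure nu1] [IsFiniteMeasure nu2]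
    (hnu1 : ∀ᵐ u ∂nu1, 0 ≤ u) (hnu2 : ∀ᵐ u ∂nu2, 0 ≤ u)
    (hBAR : ∀ x ≥ (0:ℝ), ∀ y ≥ (0:ℝ),
      ((x - y) ^ 2 + lam * x + lam * y) * (∫ p, Real.exp (-x * p.1 - y * p.2) ∂pim)
        = (x - y / 2) * (∫ u, Real.exp (-y * u) ∂nu1)
          + (y - x / 2) * (∫ u, Real.exp (-x * u) ∂nu2)) :
    nu1.real univ = 2 * lam ∧ nu2.real univ = 2 * lam := by
  have hid : Tendsto (fun x : ℝ => x + lam) (𝓝[>] 0) (𝓝 (0 + lam)) :=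
    ((by fun_prop : Continuous fun x : ℝ => x + lam).tendsto 0).mono_left nhdsWithin_le_nhds
  have e1 : lam = nu1.real univ - nu2.real univ / 2 := by
    have hL := hid.mul (tendsto_integral_exp_neg_mul (μ := pim) measurable_fst
      (hpim.mono fun p hp => hp.1))
    have hR := ((tendsto_integral_exp_neg_mul (μ := nu2) measurable_id hnu2).div_const 2).const_sub
      (nu1.real univ)
    simp only [zero_add, probReal_univ, mul_one] at hL
    refine tendsto_nhds_unique (hL.congr' ?_) hR
    filter_upwards [self_mem_nhdsWithin] with x hx
    have hx' : 0 < x := hx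
    have h := hBAR x hx'.le 0 le_rfl
    simp only [neg_zero, zero_mul, Real.exp_zero, integral_const, smul_eq_mul, mul_one, sub_zero]
      at h
    apply mul_left_cancel₀ hx'.ne'
    simp only [id]
    linear_combination h
  have e2 : lam = nu2.real univ - nu1.real univ / 2 := by
    have hL := hid.mul (tendsto_integral_exp_neg_mul (μ := pim) measurable_snd
      (hpim.mono fun p hp => hp.2))
    have hR := ((tendsto_integral_exp_neg_mul (μ := nu1) measurable_id hnu1).div_const 2).const_sub
      (nu2.real univ)
    simp only [zero_add, probReal_univ, mul_one] at hL
    refine tendsto_nhds_unique (hL.congr' ?_) hR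
    filter_upwards [self_mem_nhdsWithin] with x hx
    have hx' : 0 < x := hx
    have h := hBAR 0 le_rfl x hx'.le
    simp only [neg_zero, zero_mul, Real.exp_zero, integral_const, smul_eq_mul, mul_one, zero_sub,
      ← neg_mul] at h
    apply mul_left_cancel₀ hx'.ne'
    simp only [id]
    linear_combination h
  constructor <;> linarith

/-- The Laplace transform of `pim` is determined by the basic adjoint relationship. -/
theorem integral_exp_eq_laplaceFormula (hlam : 0 < lam) [IsProbabilityMeasure pim]
    (hpim : ∀ᵐ p ∂pim, 0 ≤ p.1 ∧ 0 ≤ p.2)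
    [IsFiniteMeasure nu1] [IsFiniteMeasure nu2]
    (hnu1 : ∀ᵐ u ∂nu1, 0 ≤ u) (hnu2 : ∀ᵐ u ∂nu2, 0 ≤ u)
    (hBAR : ∀ x ≥ (0:ℝ), ∀ y ≥ (0:ℝ),
      ((x - y) ^ 2 + lam * x + lam * y) * (∫ p, Real.exp (-x * p.1 - y * p.2) ∂pim)
        = (x - y / 2) * (∫ u, Real.exp (-y * u) ∂nu1)
          + (y - x / 2) * (∫ u, Real.exp (-x * u) ∂nu2))
    {X Y : ℝ} (hX : 1 ≤ X) (hY : 1 ≤ Y) :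
    ∫ p, Real.exp (-(lam * X) * p.1 - (lam * Y) * p.2) ∂pim = laplaceFormula X Y := by
  obtain ⟨m1, m2⟩ := bar_masses hpim hnu1 hnu2 hBAR
  have hl : (lam : ℂ) ≠ 0 := by exact_mod_cast hlam.ne'
  have hsol : ∀ {X : ℝ}, 1 ≤ X → _ := fun {X} hX =>
    LaplaceLike.eq_sechSum (κ := 2 * lam) (X := X)
    (LaplaceLike.laplace_mul hnu1 hlam m1.le) (LaplaceLike.laplace_mul hnu2 hlam m2.le)
    (by have := laplace_ofReal nu1 0; simp [m1] at this; simpa using this)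
    (by have := laplace_ofReal nu2 0; simp [m2] at this; simpa using this)
    (fun s hs0 hx hy => by
      have h := bar_complex hpim hnu1 hnu2 hBAR (x := lam * parabolaX s)
        (y := lam * parabolaX (-s)) (by rw [Complex.re_ofReal_mul]; exact mul_pos hlam hx)
        (by rw [Complex.re_ofReal_mul]; exact mul_pos hlam hy)
      have h1 : ((lam * parabolaX s - lam * parabolaX (-s)) ^ 2 + lam * (lam * parabolaX s)
          + lam * (lam * parabolaX (-s)) : ℂ) = 0 := by unfold parabolaX; ring
      have h2 : (lam * parabolaX s - lam * parabolaX (-s) / 2 : ℂ) = lam * s / 4 * (3 - s) := by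
        unfold parabolaX; ring
      have h3 : (lam * parabolaX (-s) - lam * parabolaX s / 2 : ℂ) = -(lam * s / 4 * (3 + s)) := by
        unfold parabolaX; ring
      rw [h1, h2, h3, zero_mul] at h
      apply mul_left_cancel₀ (mul_ne_zero hl hs0)
      linear_combination (-4) * h) hX
  have hn1 := (hsol hY).1
  have hn2 := (hsol hX).2
  simp only [← Complex.ofReal_mul, laplace_ofReal] at hn1 hn2
  have hn1' := Complex.ofReal_inj.1 hn1
  have hn2' := Complex.ofReal_inj.1 hn2
  have h := hBAR (lam * X) (by positivity) (lam * Y) (by positivity)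
  rw [hn1', hn2'] at h
  have hK : 0 < parabola X Y := parabola_pos hX hY
  have hK' : parabola Y X = parabola X Y := by unfold parabola; ring
  have e : (lam * X - lam * Y) ^ 2 + lam * (lam * X) + lam * (lam * Y) = lam ^ 2 * parabola X Y := by
    unfold parabola; ring
  rw [e] at h
  apply mul_left_cancel₀ (mul_ne_zero (pow_ne_zero 2 hlam.ne') hK.ne')
  rw [h, laplaceFormula, oddCoeff, oddCoeff, hK']
  field_simp
  ring

end Apply

section SeriesIntegral

open Filter Topology

variable {α : Type*} [MeasurableSpace α] {μ : Measure α} {F : ℕ → α → ℝ}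

lemma tsum_lintegral_enorm_ne_top (hF_int : ∀ n, Integrable (F n) μ)
    (hF_sum : Summable fun n => ∫ a, ‖F n a‖ ∂μ) : ∑' n, ∫⁻ a, ‖F n a‖ₑ ∂μ ≠ ⊤ := by
  simp_rw [← fun n => ofReal_integral_norm_eq_lintegral_enorm (hF_int n)]
  exact hF_sum.tsum_ofReal_ne_top

lemma ae_summable_norm_of_summable_integral_norm (hF_int : ∀ n, Integrable (F n) μ)
    (hF_sum : Summable fun n => ∫ a, ‖F n a‖ ∂μ) : ∀ᵐ a ∂μ, Summable fun n => ‖F n a‖ := by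
  refine summable_norm_of_tsum_eLpNorm_ne_top (p := 1) le_rfl
    (fun n => (hF_int n).aestronglyMeasurable) ?_
  simp_rw [eLpNorm_one_eq_lintegral_enorm]
  exact tsum_lintegral_enorm_ne_top hF_int hF_sum

lemma integrable_tsum_of_summable_integral_norm (hF_int : ∀ n, Integrable (F n) μ)
    (hF_sum : Summable fun n => ∫ a, ‖F n a‖ ∂μ) : Integrable (fun a => ∑' n, F n a) μ := by
  refine ⟨?_, ?_⟩
  · refine aestronglyMeasurable_of_tendsto_ae atTop (f := fun N a => ∑ n ∈ Finset.range N, F n a)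
      (fun N => (integrable_finsetSum _ fun n _ => hF_int n).aestronglyMeasurable) ?_
    filter_upwards [ae_summable_norm_of_summable_integral_norm hF_int hF_sum] with a ha
    exact ha.of_norm.hasSum.tendsto_sum_nat
  · have hle : ∫⁻ a, ‖∑' n, F n a‖ₑ ∂μ ≤ ∑' n, ∫⁻ a, ‖F n a‖ₑ ∂μ := by
      rw [← lintegral_tsum fun n => (hF_int n).aestronglyMeasurable.enorm]
      exact lintegral_mono fun a => enorm_tsum_le_tsum_enorm
    exact hle.trans_lt (tsum_lintegral_enorm_ne_top hF_int hF_sum).lt_top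

lemma integrable_diagDiff {φ : ℝ → ℝ → α → ℝ} {X Y : ℝ}
    (h : ∀ t : ℝ, 0 ≤ t → Integrable (φ (X + t) (Y + t)) μ) :
    Integrable (fun a => diagDiff (fun X Y => φ X Y a) X Y) μ := by
  have h0 : Integrable (φ X Y) μ := by simpa using h 0 le_rfl
  exact ((h0.sub ((h 1 (by norm_num)).const_mul 3)).add ((h 2 (by norm_num)).const_mul 3)).sub
    (h 3 (by norm_num))

lemma integral_diagDiff {φ : ℝ → ℝ → α → ℝ} {X Y : ℝ}
    (h : ∀ t : ℝ, 0 ≤ t → Integrable (φ (X + t) (Y + t)) μ) :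
    ∫ a, diagDiff (fun X Y => φ X Y a) X Y ∂μ = diagDiff (fun X Y => ∫ a, φ X Y a ∂μ) X Y := by
  have h0 : Integrable (φ X Y) μ := by simpa using h 0 le_rfl
  have h1 := (h 1 (by norm_num)).const_mul 3
  have h2 := (h 2 (by norm_num)).const_mul 3
  have h3 := h 3 (by norm_num)
  have h01 : Integrable (fun a => φ X Y a - 3 * φ (X + 1) (Y + 1) a) μ := h0.sub h1
  have h012 : Integrable (fun a => φ X Y a - 3 * φ (X + 1) (Y + 1) a
    + 3 * φ (X + 2) (Y + 2) a) μ := h01.add h2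
  simp only [diagDiff]
  rw [integral_sub h012 h3, integral_add h01 h2, integral_sub h0 h1, integral_const_mul,
    integral_const_mul]

end SeriesIntegral

section Density

open Filter Topology

/-- Lebesgue measure on the open quadrant. -/
noncomputable def quadrantVolume : Measure (ℝ × ℝ) :=
  volume.restrict (Ioi (0:ℝ) ×ˢ Ioi (0:ℝ))

lemma quadrantVolume_eq_prod : quadrantVolume
    = (volume.restrict (Ioi (0:ℝ))).prod (volume.restrict (Ioi (0:ℝ))) := by
  rw [quadrantVolume, Measure.prod_restrict, Measure.volume_eq_prod]

lemma ae_quadrantVolume : ∀ᵐ q ∂quadrantVolume, 0 < q.1 ∧ 0 < q.2 :=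
  (ae_restrict_mem (measurableSet_Ioi.prod measurableSet_Ioi)).mono fun _ h => h

/-- The exponential `exp (-λ (A u + B v))`. -/
noncomputable def expPair (lam A B : ℝ) (q : ℝ × ℝ) : ℝ := Real.exp (-(lam * (A * q.1 + B * q.2)))

lemma expPair_eq_mul (lam A B : ℝ) (q : ℝ × ℝ) :
    expPair lam A B q = Real.exp (-(lam * A) * q.1) * Real.exp (-(lam * B) * q.2) := by
  rw [expPair, ← Real.exp_add]; ring_nf

lemma expPair_pos (lam A B : ℝ) (q : ℝ × ℝ) : 0 < expPair lam A B q := Real.exp_pos _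

lemma measurable_expPair (lam A B : ℝ) : Measurable (expPair lam A B) := by
  unfold expPair; fun_prop

lemma expPair_mul (lam A B A' B' : ℝ) (q : ℝ × ℝ) :
    expPair lam A B q * expPair lam A' B' q = expPair lam (A + A') (B + B') q := by
  rw [expPair, expPair, expPair, ← Real.exp_add]; ring_nf

variable {lam A B : ℝ}

lemma integrable_expPair (hlam : 0 < lam) (hA : 0 < A) (hB : 0 < B) :
    Integrable (expPair lam A B) quadrantVolume := by
  rw [quadrantVolume_eq_prod, funext (expPair_eq_mul lam A B)]
  exact Integrable.mul_prod (integrableOn_exp_mul_Ioi (neg_lt_zero.2 (mul_pos hlam hA)) 0)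
    (integrableOn_exp_mul_Ioi (neg_lt_zero.2 (mul_pos hlam hB)) 0)

lemma integral_expPair (hlam : 0 < lam) (hA : 0 < A) (hB : 0 < B) :
    ∫ q, expPair lam A B q ∂quadrantVolume = 1 / (A * B) / lam ^ 2 := by
  rw [quadrantVolume_eq_prod, funext (expPair_eq_mul lam A B),
    integral_prod_mul (fun u => Real.exp (-(lam * A) * u)) (fun v => Real.exp (-(lam * B) * v)),
    integral_exp_mul_Ioi (neg_lt_zero.2 (mul_pos hlam hA)),
    integral_exp_mul_Ioi (neg_lt_zero.2 (mul_pos hlam hB))]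
  simp
  field_simp

lemma cSymSeq_eq (n : ℕ) : cSymSeq n = (-1) ^ n * coeffPoly (n + 4) := by
  have h : ((n + 1).ascFactorial 7 : ℝ) = 5040 * ((n + 7).choose 7 : ℝ) := by
    have := Nat.ascFactorial_eq_factorial_mul_choose n 7
    rw [this]; push_cast [Nat.factorial]; ring
  simp only [Nat.ascFactorial] at h
  push_cast at h
  unfold cSymSeq coeffPoly
  linear_combination (-(-1 : ℝ) ^ n * (n + 4) / 20160) * h

/-- The `n`-th term of the symmetrised series, up to the factor `λ²`. -/
noncomputable def symTerm (lam : ℝ) (n : ℕ) (q : ℝ × ℝ) : ℝ :=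
  expPair lam (triangular (n + 4)) (triangular (n + 4 - 1)) q
    + expPair lam (triangular (n + 4 - 1)) (triangular (n + 4)) q

lemma expPair_add_swap (lam : ℝ) (n : ℕ) (q : ℝ × ℝ) :
    expPair lam (aSymSeq n) (bSymSeq n) q + expPair lam (aSymSeq n) (bSymSeq n) q.swap
      = symTerm lam n q := by
  have hs : expPair lam (aSymSeq n) (bSymSeq n) q.swap = expPair lam (bSymSeq n) (aSymSeq n) q := by
    simp only [expPair, Prod.fst_swap, Prod.snd_swap]; ring_nf
  rw [hs, symTerm]
  rcases Nat.even_or_odd' n with ⟨m, rfl | rfl⟩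
  · have ha : aSymSeq (2 * m) = triangular ((2 * m : ℕ) + 4) := by
      simp [aSymSeq, triangular]; ring
    have hb : bSymSeq (2 * m) = triangular ((2 * m : ℕ) + 4 - 1) := by
      simp [bSymSeq, triangular]; ring
    rw [ha, hb]
  · have hd : (2 * m + 1) / 2 = m := by omega
    have ha : aSymSeq (2 * m + 1) = triangular ((2 * m + 1 : ℕ) + 4 - 1) := by
      simp [aSymSeq, triangular, hd]; ring
    have hb : bSymSeq (2 * m + 1) = triangular ((2 * m + 1 : ℕ) + 4) := by
      simp [bSymSeq, triangular, hd]; ring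
    rw [ha, hb, add_comm]

lemma symTerm_pos (lam : ℝ) (n : ℕ) (q : ℝ × ℝ) : 0 < symTerm lam n q :=
  add_pos (expPair_pos ..) (expPair_pos ..)

lemma expPair_mul_symTerm (lam X Y : ℝ) (n : ℕ) (q : ℝ × ℝ) :
    expPair lam X Y q * symTerm lam n q
      = expPair lam (X + triangular (n + 4)) (Y + triangular (n + 4 - 1)) q
        + expPair lam (X + triangular (n + 4 - 1)) (Y + triangular (n + 4)) q := by
  rw [symTerm, mul_add, expPair_mul, expPair_mul]

lemma triangular_pos {k : ℝ} (hk : 0 < k) : 0 < triangular k := by unfold triangular; positivity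

variable {X Y : ℝ}

lemma integrable_expPair_mul_symTerm (hlam : 0 < lam) (hX : 0 ≤ X) (hY : 0 ≤ Y) (n : ℕ) :
    Integrable (fun q => expPair lam X Y q * symTerm lam n q) quadrantVolume := by
  have h1 : 0 < triangular (n + 4) := triangular_pos (by positivity)
  have h2 : 0 < triangular ((n : ℝ) + 4 - 1) := triangular_pos (by linarith [n.cast_nonneg (α := ℝ)])
  simp_rw [expPair_mul_symTerm]
  exact (integrable_expPair hlam (by positivity) (by positivity)).add
    (integrable_expPair hlam (by positivity) (by positivity))

lemma integral_expPair_mul_symTerm (hlam : 0 < lam) (hX : 0 ≤ X) (hY : 0 ≤ Y) (n : ℕ) :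
    ∫ q, expPair lam X Y q * symTerm lam n q ∂quadrantVolume
      = pairKernel X Y (n + 4) / lam ^ 2 := by
  have h1 : 0 < triangular (n + 4) := triangular_pos (by positivity)
  have h2 : 0 < triangular ((n : ℝ) + 4 - 1) := triangular_pos (by linarith [n.cast_nonneg (α := ℝ)])
  simp_rw [expPair_mul_symTerm]
  rw [integral_add (integrable_expPair hlam (by positivity) (by positivity))
      (integrable_expPair hlam (by positivity) (by positivity)),
    integral_expPair hlam (by positivity) (by positivity),
    integral_expPair hlam (by positivity) (by positivity), pairKernel, add_div]

lemma diagDiff_expPair (lam X Y : ℝ) (q : ℝ × ℝ) :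
    diagDiff (fun X Y => expPair lam X Y q) X Y
      = expPair lam X Y q * (1 - expPair lam 1 1 q) ^ 3 := by
  have h2 : expPair lam 2 2 q = expPair lam 1 1 q ^ 2 := by
    rw [sq, expPair_mul]; norm_num
  have h3 : expPair lam 3 3 q = expPair lam 1 1 q ^ 3 := by
    rw [pow_succ, ← h2, expPair_mul]; norm_num
  unfold diagDiff
  simp only [← expPair_mul, h2, h3]
  ring

/-- The `n`-th term of the series for the density, tempered by an exponential weight. -/
noncomputable def temperedTerm (lam X Y : ℝ) (n : ℕ) (q : ℝ × ℝ) : ℝ :=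
  diagDiff (fun X Y => expPair lam X Y q) X Y * (420 * lam ^ 2 * (cSymSeq n * symTerm lam n q))

lemma temperedTerm_eq (lam X Y : ℝ) (n : ℕ) (q : ℝ × ℝ) :
    temperedTerm lam X Y n q = 420 * lam ^ 2 * cSymSeq n *
      diagDiff (fun X Y => expPair lam X Y q * symTerm lam n q) X Y := by
  unfold temperedTerm diagDiff; ring

lemma integrable_temperedTerm (hlam : 0 < lam) (hX : 0 ≤ X) (hY : 0 ≤ Y) (n : ℕ) :
    Integrable (temperedTerm lam X Y n) quadrantVolume := by
  rw [funext (temperedTerm_eq lam X Y n)]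
  exact (integrable_diagDiff (φ := fun X Y q => expPair lam X Y q * symTerm lam n q) fun t ht =>
    integrable_expPair_mul_symTerm hlam (by positivity) (by positivity) n).const_mul _

lemma integral_temperedTerm (hlam : 0 < lam) (hX : 0 ≤ X) (hY : 0 ≤ Y) (n : ℕ) :
    ∫ q, temperedTerm lam X Y n q ∂quadrantVolume
      = 420 * ((-1) ^ n * coeffPoly (n + 4) * diagDiff (fun X Y => pairKernel X Y (n + 4)) X Y) := by
  rw [funext (temperedTerm_eq lam X Y n), integral_const_mul,
    integral_diagDiff (φ := fun X Y q => expPair lam X Y q * symTerm lam n q) fun t ht =>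
      integrable_expPair_mul_symTerm hlam (by positivity) (by positivity) n]
  simp only [diagDiff]
  rw [integral_expPair_mul_symTerm hlam hX hY,
    integral_expPair_mul_symTerm hlam (by positivity) (by positivity),
    integral_expPair_mul_symTerm hlam (by positivity) (by positivity),
    integral_expPair_mul_symTerm hlam (by positivity) (by positivity), cSymSeq_eq]
  field_simp

lemma coeffPoly_nonneg (n : ℕ) : 0 ≤ coeffPoly (n + 4) := by
  have h : coeffPoly (n + 4) = ((n : ℝ) + 4) ^ 2 * ((n + 3) * (n + 5)) * ((n + 2) * (n + 6))
      * ((n + 1) * (n + 7)) / 20160 := by unfold coeffPoly; ring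
  rw [h]; positivity

lemma one_sub_expPair_pos (hlam : 0 < lam) {q : ℝ × ℝ} (hq : 0 < q.1 ∧ 0 < q.2) :
    0 < 1 - expPair lam 1 1 q := by
  have : expPair lam 1 1 q < 1 := by
    rw [expPair, Real.exp_lt_one_iff]
    have := mul_pos hlam (add_pos hq.1 hq.2)
    linarith
  linarith

lemma norm_temperedTerm (hlam : 0 < lam) (X Y : ℝ) (n : ℕ) {q : ℝ × ℝ} (hq : 0 < q.1 ∧ 0 < q.2) :
    ‖temperedTerm lam X Y n q‖ = (-1) ^ n * temperedTerm lam X Y n q := by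
  have h1 := expPair_pos lam X Y q
  have h2 := one_sub_expPair_pos hlam hq
  have h3 := symTerm_pos lam n q
  have h4 := coeffPoly_nonneg n
  have e : temperedTerm lam X Y n q = (-1) ^ n * (expPair lam X Y q * (1 - expPair lam 1 1 q) ^ 3 *
      (420 * lam ^ 2 * (coeffPoly (n + 4) * symTerm lam n q))) := by
    rw [temperedTerm, diagDiff_expPair, cSymSeq_eq]; ring
  have hsq : ((-1 : ℝ) ^ n) * (-1) ^ n = 1 := by rw [← mul_pow]; norm_num
  rw [e, ← mul_assoc ((-1 : ℝ) ^ n) ((-1) ^ n), hsq, one_mul, norm_mul, norm_pow, norm_neg, norm_one,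
    one_pow, one_mul, Real.norm_of_nonneg (by positivity)]

lemma summable_integral_norm_temperedTerm (hlam : 0 < lam) (hX : 1 ≤ X) (hY : 1 ≤ Y) :
    Summable fun n => ∫ q, ‖temperedTerm lam X Y n q‖ ∂quadrantVolume := by
  have h := ((hasSum_diagDiff hX hY).mul_left 420).summable.abs
  refine h.congr fun n => ?_
  rw [← integral_temperedTerm hlam (by linarith) (by linarith) n]
  have e : ∫ q, ‖temperedTerm lam X Y n q‖ ∂quadrantVolume
      = (-1) ^ n * ∫ q, temperedTerm lam X Y n q ∂quadrantVolume := by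
    rw [← integral_const_mul]
    exact integral_congr_ae (ae_quadrantVolume.mono fun q hq => norm_temperedTerm hlam X Y n hq)
  have h0 : 0 ≤ ∫ q, ‖temperedTerm lam X Y n q‖ ∂quadrantVolume :=
    integral_nonneg fun q => norm_nonneg _
  rw [← abs_of_nonneg h0, e, abs_mul, abs_pow]
  simp

/-- The density of the theorem. -/
noncomputable def symDensity (lam : ℝ) (q : ℝ × ℝ) : ℝ :=
  420 * (pSym lam q.1 q.2 + pSym lam q.2 q.1)

lemma tsum_temperedTerm_ae (hlam : 0 < lam) (X Y : ℝ) : ∀ᵐ q ∂quadrantVolume,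
    ∑' n, temperedTerm lam X Y n q
      = expPair lam X Y q * (1 - expPair lam 1 1 q) ^ 3 * symDensity lam q := by
  filter_upwards [ae_quadrantVolume, ae_summable_norm_of_summable_integral_norm
    (fun n => integrable_temperedTerm hlam zero_le_one zero_le_one n)
    (summable_integral_norm_temperedTerm hlam le_rfl le_rfl)] with q hq hs
  have hw : 0 < expPair lam 1 1 q * (1 - expPair lam 1 1 q) ^ 3 * (420 * lam ^ 2) := by
    have := expPair_pos lam 1 1 q
    have := one_sub_expPair_pos hlam hq
    positivity
  have hs' : Summable fun n => |cSymSeq n| * symTerm lam n q := by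
    refine (summable_mul_left_iff hw.ne').1 (hs.congr fun n => ?_)
    rw [temperedTerm, diagDiff_expPair, ← mul_assoc, norm_mul, Real.norm_of_nonneg hw.le, norm_mul,
      Real.norm_eq_abs, Real.norm_of_nonneg (symTerm_pos lam n q).le]
  have hterm : ∀ r : ℝ × ℝ, (∀ n, expPair lam (aSymSeq n) (bSymSeq n) r ≤ symTerm lam n q) →
      Summable fun n => cSymSeq n * expPair lam (aSymSeq n) (bSymSeq n) r := by
    intro r hr
    refine Summable.of_norm_bounded hs' fun n => ?_
    rw [norm_mul, Real.norm_eq_abs, Real.norm_of_nonneg (expPair_pos ..).le]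
    exact mul_le_mul_of_nonneg_left (hr n) (abs_nonneg _)
  have hs1 := hterm q fun n => by
    rw [← expPair_add_swap]; linarith [expPair_pos lam (aSymSeq n) (bSymSeq n) q.swap]
  have hs2 := hterm q.swap fun n => by
    rw [← expPair_add_swap]; linarith [expPair_pos lam (aSymSeq n) (bSymSeq n) q]
  have hd : symDensity lam q = 420 * lam ^ 2 * ∑' n, cSymSeq n * symTerm lam n q := by
    have h1 : pSym lam q.1 q.2
        = lam ^ 2 * ∑' n, cSymSeq n * expPair lam (aSymSeq n) (bSymSeq n) q := rfl
    have h2 : pSym lam q.2 q.1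
        = lam ^ 2 * ∑' n, cSymSeq n * expPair lam (aSymSeq n) (bSymSeq n) q.swap := rfl
    rw [symDensity, h1, h2, ← mul_add, ← hs1.tsum_add hs2, ← mul_assoc]
    congr 2
    funext n
    rw [← mul_add, expPair_add_swap]
  simp only [temperedTerm, tsum_mul_left, diagDiff_expPair, hd]

lemma integrable_expPair_mul_symDensity (hlam : 0 < lam) (hX : 1 ≤ X) (hY : 1 ≤ Y) :
    Integrable (fun q => expPair lam X Y q * (1 - expPair lam 1 1 q) ^ 3 * symDensity lam q)
      quadrantVolume :=
  (integrable_tsum_of_summable_integral_norm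
    (fun n => integrable_temperedTerm hlam (by linarith) (by linarith) n)
    (summable_integral_norm_temperedTerm hlam hX hY)).congr (tsum_temperedTerm_ae hlam X Y)

lemma integral_expPair_mul_symDensity (hlam : 0 < lam) (hX : 1 ≤ X) (hY : 1 ≤ Y) :
    ∫ q, expPair lam X Y q * (1 - expPair lam 1 1 q) ^ 3 * symDensity lam q ∂quadrantVolume
      = diagDiff laplaceFormula X Y := by
  rw [← integral_congr_ae (tsum_temperedTerm_ae hlam X Y)]
  have h := hasSum_integral_of_summable_integral_norm
    (fun n => integrable_temperedTerm (X := X) (Y := Y) hlam (by linarith) (by linarith) n)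
    (summable_integral_norm_temperedTerm hlam hX hY)
  simp_rw [integral_temperedTerm hlam (zero_le_one.trans hX) (zero_le_one.trans hY)] at h
  rw [h.unique ((hasSum_diagDiff hX hY).mul_left 420)]
  ring

end Density

section Uniqueness

open Filter Topology BoundedContinuousFunction
open scoped NNReal

/-- The bounded continuous function `exp (-λ (m u + n v))` on the closed quadrant. -/
noncomputable def expBCF (lam : ℝ≥0) (m n : ℕ) : (ℝ≥0 × ℝ≥0) →ᵇ ℝ :=
  BoundedContinuousFunction.ofNormedAddCommGroup
    (fun q => Real.exp (-(lam * (m * q.1 + n * q.2)))) (by fun_prop) 1 fun q => by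
      rw [Real.norm_eq_abs, Real.abs_exp, Real.exp_le_one_iff]
      exact neg_nonpos.2 (by positivity)

lemma expBCF_apply (lam : ℝ≥0) (m n : ℕ) (q : ℝ≥0 × ℝ≥0) :
    expBCF lam m n q = Real.exp (-(lam * (m * q.1 + n * q.2))) := rfl

/-- The algebra of exponential polynomials on the closed quadrant. -/
noncomputable def expAlgebra (lam : ℝ≥0) : StarSubalgebra ℝ ((ℝ≥0 × ℝ≥0) →ᵇ ℝ) where
  toSubalgebra := Algebra.adjoin ℝ (range fun k : ℕ × ℕ => expBCF lam k.1 k.2)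
  star_mem' {f} hf := by
    have : star f = f := by ext q; simp
    rw [this]; exact hf

lemma expBCF_mem (lam : ℝ≥0) (m n : ℕ) : expBCF lam m n ∈ expAlgebra lam :=
  Algebra.subset_adjoin ⟨(m, n), rfl⟩

lemma mem_expAlgebra_iff {lam : ℝ≥0} {f : (ℝ≥0 × ℝ≥0) →ᵇ ℝ} : f ∈ expAlgebra lam ↔
    f ∈ Submodule.span ℝ (range fun k : ℕ × ℕ => expBCF lam k.1 k.2) := by
  have hcl : (Submonoid.closure (range fun k : ℕ × ℕ => expBCF lam k.1 k.2) : Set _)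
      = range fun k : ℕ × ℕ => expBCF lam k.1 k.2 := by
    refine Subset.antisymm (fun g hg => ?_) Submonoid.subset_closure
    refine Submonoid.closure_induction (fun g hg => hg) ⟨(0, 0), ?_⟩ ?_ hg
    · ext q; simp [expBCF_apply]
    · rintro _ _ _ _ ⟨k, rfl⟩ ⟨l, rfl⟩
      refine ⟨(k.1 + l.1, k.2 + l.2), ?_⟩
      ext q
      simp only [BoundedContinuousFunction.coe_mul, Pi.mul_apply, expBCF_apply, ← Real.exp_add]
      push_cast
      ring_nf
  rw [← hcl, ← Algebra.adjoin_eq_span]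
  rfl

lemma expAlgebra_separatesPoints {lam : ℝ≥0} (hlam : 0 < lam) :
    ((expAlgebra lam).map (toContinuousMapStarₐ ℝ)).SeparatesPoints := by
  intro p q hpq
  have hl : (lam : ℝ) ≠ 0 := by exact_mod_cast hlam.ne'
  have hne : p.1 ≠ q.1 ∨ p.2 ≠ q.2 := by
    by_contra! h; exact hpq (Prod.ext h.1 h.2)
  rcases hne with h | h
  · refine ⟨_, ⟨_, ⟨expBCF lam 1 0, expBCF_mem lam 1 0, rfl⟩, rfl⟩, ?_⟩
    simpa [expBCF_apply, hl] using h
  · refine ⟨_, ⟨_, ⟨expBCF lam 0 1, expBCF_mem lam 0 1, rfl⟩, rfl⟩, ?_⟩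
    simpa [expBCF_apply, hl] using h

lemma ext_of_integral_expBCF {lam : ℝ≥0} (hlam : 0 < lam)
    {ρ σ : Measure (ℝ≥0 × ℝ≥0)} [IsFiniteMeasure ρ] [IsFiniteMeasure σ]
    (h : ∀ m n : ℕ, ∫ q, expBCF lam m n q ∂ρ = ∫ q, expBCF lam m n q ∂σ) : ρ = σ := by
  refine ext_of_forall_mem_subalgebra_integral_eq_of_polish (expAlgebra_separatesPoints hlam)
    fun g hg => ?_
  refine Submodule.span_induction ?_ ?_ ?_ ?_ (mem_expAlgebra_iff.1 hg)
  · rintro _ ⟨k, rfl⟩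
    exact h k.1 k.2
  · simp
  · intro f g _ _ hf hg
    simp only [BoundedContinuousFunction.coe_add, Pi.add_apply]
    rw [integral_add (f.integrable ρ) (g.integrable ρ), integral_add (f.integrable σ)
      (g.integrable σ), hf, hg]
  · intro a f _ hf
    simp only [BoundedContinuousFunction.coe_smul, integral_smul, hf]

/-- A finite measure on the quadrant is determined by its Laplace transform at the lattice
points `(λ m, λ n)`. -/
theorem ext_of_integral_expPair {lam : ℝ} (hlam : 0 < lam)
    {ρ σ : Measure (ℝ × ℝ)} [IsFiniteMeasure ρ] [IsFiniteMeasure σ]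
    (hρ : ∀ᵐ q ∂ρ, 0 < q.1 ∧ 0 < q.2) (hσ : ∀ᵐ q ∂σ, 0 < q.1 ∧ 0 < q.2)
    (h : ∀ m n : ℕ, ∫ q, expPair lam m n q ∂ρ = ∫ q, expPair lam m n q ∂σ) : ρ = σ := by
  set T : ℝ × ℝ → ℝ≥0 × ℝ≥0 := fun q => (q.1.toNNReal, q.2.toNNReal) with hT
  set I : ℝ≥0 × ℝ≥0 → ℝ × ℝ := fun q => (q.1, q.2) with hI
  have hTm : Measurable T := by fun_prop
  have hIm : Measurable I := by fun_prop
  have hIT : ∀ {q : ℝ × ℝ}, 0 < q.1 ∧ 0 < q.2 → I (T q) = q := by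
    intro q hq
    ext <;> simp [hI, hT, hq.1.le, hq.2.le]
  have hback : ∀ {τ : Measure (ℝ × ℝ)}, (∀ᵐ q ∂τ, 0 < q.1 ∧ 0 < q.2) → (τ.map T).map I = τ := by
    intro τ hτ
    rw [Measure.map_map hIm hTm, Measure.map_congr (f := I ∘ T) (g := id) (hτ.mono fun q hq => hIT hq),
      Measure.map_id]
  have h_int : ∀ {τ : Measure (ℝ × ℝ)}, (∀ᵐ q ∂τ, 0 < q.1 ∧ 0 < q.2) → ∀ m n : ℕ,
      ∫ q, expBCF lam.toNNReal m n q ∂(τ.map T) = ∫ q, expPair lam m n q ∂τ := by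
    intro τ hτ m n
    rw [integral_map hTm.aemeasurable
      (expBCF lam.toNNReal m n).continuous.measurable.aestronglyMeasurable]
    refine integral_congr_ae (hτ.mono fun q hq => ?_)
    simp only [expBCF_apply, expPair, hT]
    rw [Real.coe_toNNReal _ hlam.le, Real.coe_toNNReal _ hq.1.le, Real.coe_toNNReal _ hq.2.le]
  rw [← hback hρ, ← hback hσ]
  congr 1
  have : IsFiniteMeasure (ρ.map T) := inferInstance
  refine ext_of_integral_expBCF (Real.toNNReal_pos.2 hlam) fun m n => ?_
  rw [h_int hρ, h_int hσ, h]

end Uniqueness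

section Density

lemma expPair_le_one {lam A B : ℝ} (hlam : 0 < lam) (hA : 0 ≤ A) (hB : 0 ≤ B) {q : ℝ × ℝ}
    (hq : 0 < q.1 ∧ 0 < q.2) : expPair lam A B q ≤ 1 := by
  obtain ⟨h1, h2⟩ := hq
  rw [expPair, Real.exp_le_one_iff]
  exact neg_nonpos.2 (by positivity)

lemma integrable_expPair_mul {lam A B : ℝ} (hlam : 0 < lam) (hA : 0 ≤ A) (hB : 0 ≤ B)
    {μ : Measure (ℝ × ℝ)} (hμ : ∀ᵐ q ∂μ, 0 < q.1 ∧ 0 < q.2) {F : ℝ × ℝ → ℝ}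
    (hF : Integrable F μ) : Integrable (fun q => expPair lam A B q * F q) μ := by
  refine hF.bdd_mul (c := 1) (measurable_expPair ..).aestronglyMeasurable ?_
  filter_upwards [hμ] with q hq
  rw [Real.norm_eq_abs, abs_of_pos (expPair_pos ..)]
  exact expPair_le_one hlam hA hB hq

lemma integral_withDensity_ofReal {α : Type*} [MeasurableSpace α] {μ : Measure α} {F : α → ℝ}
    (hF : AEMeasurable F μ) (g : α → ℝ) :
    ∫ a, g a ∂μ.withDensity (fun a => ENNReal.ofReal (F a)) = ∫ a, g a * max (F a) 0 ∂μ := by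
  rw [integral_withDensity_eq_integral_toReal_smul₀ hF.ennreal_ofReal
    (.of_forall fun _ => ENNReal.ofReal_lt_top)]
  simp only [ENNReal.toReal_ofReal', smul_eq_mul, mul_comm]

/-- A finite measure on the open quadrant whose Laplace transform agrees, on a lattice, with that
of the signed measure with density `F` has density `F`; in particular `F` is nonnegative. -/
lemma eq_withDensity_of_integral_expPair {lam : ℝ} (hlam : 0 < lam) {ρ μ : Measure (ℝ × ℝ)}
    [IsFiniteMeasure ρ] [SigmaFinite μ] (hρ : ∀ᵐ q ∂ρ, 0 < q.1 ∧ 0 < q.2)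
    (hμ : ∀ᵐ q ∂μ, 0 < q.1 ∧ 0 < q.2) {F : ℝ × ℝ → ℝ} (hF : Integrable F μ)
    (h : ∀ m n : ℕ, ∫ q, expPair lam m n q ∂ρ = ∫ q, expPair lam m n q * F q ∂μ) :
    ρ = μ.withDensity fun q => ENNReal.ofReal (F q) := by
  have hfin : IsFiniteMeasure (μ.withDensity fun q => ENNReal.ofReal (F q)) :=
    isFiniteMeasure_withDensity_ofReal hF.2
  have hfin' : IsFiniteMeasure (μ.withDensity fun q => ENNReal.ofReal (-F q)) :=
    isFiniteMeasure_withDensity_ofReal hF.neg.2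
  have hpos : ∀ f : ℝ × ℝ → ENNReal, ∀ᵐ q ∂μ.withDensity f, 0 < q.1 ∧ 0 < q.2 := fun f =>
    (withDensity_absolutelyContinuous μ f).ae_le hμ
  have hsplit : ρ + μ.withDensity (fun q => ENNReal.ofReal (-F q))
      = μ.withDensity fun q => ENNReal.ofReal (F q) := by
    refine ext_of_integral_expPair hlam (ae_add_measure_iff.2 ⟨hρ, hpos _⟩) (hpos _) fun m n => ?_
    have h_int : ∀ {ν : Measure (ℝ × ℝ)} [IsFiniteMeasure ν], (∀ᵐ q ∂ν, 0 < q.1 ∧ 0 < q.2) →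
        Integrable (fun q => expPair lam m n q) ν := fun hν => by
      simpa using integrable_expPair_mul hlam m.cast_nonneg n.cast_nonneg hν
        (integrable_const (1 : ℝ))
    rw [integral_add_measure (h_int hρ) (h_int (hpos _)), h,
      integral_withDensity_ofReal hF.aemeasurable.fun_neg,
      integral_withDensity_ofReal hF.aemeasurable, ← integral_add]
    · refine integral_congr_ae (.of_forall fun q => ?_)
      have : F q + max (-F q) 0 = max (F q) 0 := by grind
      simp only [← this, mul_add]
    · exact integrable_expPair_mul hlam m.cast_nonneg n.cast_nonneg hμ hF
    · exact integrable_expPair_mul hlam m.cast_nonneg n.cast_nonneg hμ hF.neg.pos_part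
  have hnonneg : (fun q => ENNReal.ofReal (-F q)) ≤ᵐ[μ] fun q => ENNReal.ofReal (F q) := by
    refine ae_le_of_forall_setLIntegral_le_of_sigmaFinite₀ hF.aemeasurable.neg.ennreal_ofReal
      fun s hs _ => ?_
    rw [← withDensity_apply _ hs, ← withDensity_apply _ hs, ← hsplit]
    exact le_add_self
  have hzero : (fun q => ENNReal.ofReal (-F q)) =ᵐ[μ] 0 := by
    filter_upwards [hnonneg] with q hq
    rw [Pi.zero_apply, ENNReal.ofReal_eq_zero]
    by_contra! hneg
    rw [ENNReal.ofReal_of_nonpos (p := F q) (by linarith), nonpos_iff_eq_zero,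
      ENNReal.ofReal_eq_zero] at hq
    linarith
  rwa [withDensity_congr_ae hzero, withDensity_zero, add_zero] at hsplit

lemma withDensity_right_cancel {α : Type*} [MeasurableSpace α] {ρ σ : Measure α}
    {f : α → ENNReal} (hf : Measurable f) (hρ : ∀ᵐ a ∂ρ, f a ≠ 0) (hσ : ∀ᵐ a ∂σ, f a ≠ 0)
    (htop : ∀ a, f a ≠ ⊤) (h : ρ.withDensity f = σ.withDensity f) : ρ = σ := by
  rw [← withDensity_inv_same hf hρ (.of_forall htop), h,
    withDensity_inv_same hf hσ (.of_forall htop)]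

/-- The weight that makes the formal density integrable term by term. -/
noncomputable def quadrantWeight (lam : ℝ) (q : ℝ × ℝ) : ℝ :=
  expPair lam 1 1 q * (1 - expPair lam 1 1 q) ^ 3

lemma measurable_quadrantWeight (lam : ℝ) : Measurable (quadrantWeight lam) :=
  (measurable_expPair ..).mul ((measurable_const.sub (measurable_expPair ..)).pow_const 3)

lemma quadrantWeight_pos {lam : ℝ} (hlam : 0 < lam) {q : ℝ × ℝ} (hq : 0 < q.1 ∧ 0 < q.2) :
    0 < quadrantWeight lam q :=
  mul_pos (expPair_pos ..) (pow_pos (one_sub_expPair_pos hlam hq) 3)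

lemma quadrantWeight_le_one {lam : ℝ} (hlam : 0 < lam) {q : ℝ × ℝ} (hq : 0 < q.1 ∧ 0 < q.2) :
    quadrantWeight lam q ≤ 1 :=
  mul_le_one₀ (expPair_le_one hlam zero_le_one zero_le_one hq)
    (pow_nonneg (one_sub_expPair_pos hlam hq).le 3)
    (pow_le_one₀ (one_sub_expPair_pos hlam hq).le (by linarith [expPair_pos lam 1 1 q]))

lemma expPair_mul_quadrantWeight (lam A B : ℝ) (q : ℝ × ℝ) :
    expPair lam A B q * quadrantWeight lam q
      = expPair lam (A + 1) (B + 1) q * (1 - expPair lam 1 1 q) ^ 3 := by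
  rw [quadrantWeight, ← mul_assoc, expPair_mul]

lemma eq_withDensity_symDensity {lam : ℝ} (hlam : 0 < lam) {pim : Measure (ℝ × ℝ)}
    [IsFiniteMeasure pim] (hpim : ∀ᵐ q ∂pim, 0 < q.1 ∧ 0 < q.2)
    (h : ∀ X Y : ℝ, 1 ≤ X → 1 ≤ Y → ∫ q, expPair lam X Y q ∂pim = laplaceFormula X Y) :
    pim = quadrantVolume.withDensity fun q => ENNReal.ofReal (symDensity lam q) := by
  have hsf : SigmaFinite quadrantVolume := by unfold quadrantVolume; infer_instance
  have hwm := measurable_quadrantWeight lam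
  have hF : Integrable (fun q => quadrantWeight lam q * symDensity lam q) quadrantVolume :=
    integrable_expPair_mul_symDensity hlam le_rfl le_rfl
  have hw : Integrable (quadrantWeight lam) pim := by
    refine .of_bound hwm.aestronglyMeasurable 1 ?_
    filter_upwards [hpim] with q hq
    rw [Real.norm_eq_abs, abs_of_pos (quadrantWeight_pos hlam hq)]
    exact quadrantWeight_le_one hlam hq
  have hfin : IsFiniteMeasure (pim.withDensity fun q => ENNReal.ofReal (quadrantWeight lam q)) :=
    isFiniteMeasure_withDensity_ofReal hw.2
  have hsym : AEMeasurable (symDensity lam) quadrantVolume := by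
    refine (hF.aemeasurable.div hwm.aemeasurable).congr ?_
    filter_upwards [ae_quadrantVolume] with q hq
    exact mul_div_cancel_left₀ _ (quadrantWeight_pos hlam hq).ne'
  have hne : ∀ {ν : Measure (ℝ × ℝ)}, (∀ᵐ q ∂ν, 0 < q.1 ∧ 0 < q.2) →
      ∀ᵐ q ∂ν, ENNReal.ofReal (quadrantWeight lam q) ≠ 0 := fun hν => by
    filter_upwards [hν] with q hq
    exact (ENNReal.ofReal_pos.2 (quadrantWeight_pos hlam hq)).ne'
  refine withDensity_right_cancel hwm.ennreal_ofReal (hne hpim)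
    (hne ((withDensity_absolutelyContinuous _ _).ae_le ae_quadrantVolume))
    (fun _ => ENNReal.ofReal_ne_top) ?_
  rw [← withDensity_mul₀ hsym.ennreal_ofReal hwm.ennreal_ofReal.aemeasurable]
  have hprod : ((fun q => ENNReal.ofReal (symDensity lam q))
      * fun q => ENNReal.ofReal (quadrantWeight lam q)) =ᵐ[quadrantVolume]
        fun q => ENNReal.ofReal (quadrantWeight lam q * symDensity lam q) := by
    filter_upwards [ae_quadrantVolume] with q hq
    rw [Pi.mul_apply, mul_comm, ENNReal.ofReal_mul (quadrantWeight_pos hlam hq).le]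
  rw [withDensity_congr_ae hprod]
  refine eq_withDensity_of_integral_expPair hlam
    ((withDensity_absolutelyContinuous _ _).ae_le hpim) ae_quadrantVolume hF fun m n => ?_
  have hm : (1 : ℝ) ≤ m + 1 := by linarith [m.cast_nonneg (α := ℝ)]
  have hn : (1 : ℝ) ≤ n + 1 := by linarith [n.cast_nonneg (α := ℝ)]
  have h_int : ∀ t : ℝ, 0 ≤ t → Integrable (expPair lam (m + 1 + t) (n + 1 + t)) pim :=
    fun t ht => by
      simpa using integrable_expPair_mul hlam (by linarith : 0 ≤ (m : ℝ) + 1 + t)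
        (by linarith : 0 ≤ (n : ℝ) + 1 + t) hpim (integrable_const (1 : ℝ))
  calc ∫ q, expPair lam m n q ∂pim.withDensity (fun q => ENNReal.ofReal (quadrantWeight lam q))
      = ∫ q, diagDiff (fun X Y => expPair lam X Y q) (m + 1) (n + 1) ∂pim := by
        rw [integral_withDensity_ofReal hwm.aemeasurable]
        refine integral_congr_ae ?_
        filter_upwards [hpim] with q hq
        rw [max_eq_left (quadrantWeight_pos hlam hq).le, expPair_mul_quadrantWeight,
          diagDiff_expPair]
    _ = diagDiff laplaceFormula (m + 1) (n + 1) := by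
        rw [integral_diagDiff (φ := fun X Y q => expPair lam X Y q) h_int]
        simp only [diagDiff]
        rw [h _ _ hm hn, h _ _ (by linarith) (by linarith), h _ _ (by linarith) (by linarith),
          h _ _ (by linarith) (by linarith)]
    _ = ∫ q, expPair lam m n q * (quadrantWeight lam q * symDensity lam q) ∂quadrantVolume := by
        simp only [← mul_assoc, expPair_mul_quadrantWeight]
        exact (integral_expPair_mul_symDensity hlam hm hn).symm

end Density

/-- Corollary (density of the invariant measure, symmetric case): if `λ1 = λ2 = λ > 0` and
`(π, ν1, ν2)` satisfies the basic adjoint relationship, then `π` is absolutely continuous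
with respect to Lebesgue measure on `(0,∞)²` with density `π(u,v) = 420 (p(u,v) + p(v,u))`. -/
theorem invariant_density_symmetric
    (lam : ℝ) (hlam : 0 < lam)
    (pim : Measure (ℝ × ℝ)) [IsProbabilityMeasure pim]
    (hpim : pim ((Ioi (0:ℝ) ×ˢ Ioi (0:ℝ))ᶜ) = 0)
    (nu1 nu2 : Measure ℝ) [IsFiniteMeasure nu1] [IsFiniteMeasure nu2]
    (hnu1 : nu1 (Ioi (0:ℝ))ᶜ = 0) (hnu2 : nu2 (Ioi (0:ℝ))ᶜ = 0)
    (hBAR : ∀ x ≥ (0:ℝ), ∀ y ≥ (0:ℝ),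
      ((x - y) ^ 2 + lam * x + lam * y) * (∫ p, Real.exp (-x * p.1 - y * p.2) ∂pim)
        = (x - y / 2) * (∫ u, Real.exp (-y * u) ∂nu1)
          + (y - x / 2) * (∫ u, Real.exp (-x * u) ∂nu2)) :
    pim = (volume.restrict (Ioi (0:ℝ) ×ˢ Ioi (0:ℝ))).withDensity
        (fun q => ENNReal.ofReal (420 * (pSym lam q.1 q.2 + pSym lam q.2 q.1))) := by
  have hpos : ∀ᵐ q ∂pim, 0 < q.1 ∧ 0 < q.2 := mem_ae_iff.2 hpim
  have hpos1 : ∀ᵐ u ∂nu1, 0 < u := mem_ae_iff.2 hnu1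
  have hpos2 : ∀ᵐ u ∂nu2, 0 < u := mem_ae_iff.2 hnu2
  refine eq_withDensity_symDensity hlam hpos fun X Y hX hY => ?_
  rw [← integral_exp_eq_laplaceFormula hlam (hpos.mono fun _ hq => ⟨hq.1.le, hq.2.le⟩)
    (hpos1.mono fun _ hu => hu.le) (hpos2.mono fun _ hu => hu.le) hBAR hX hY]
  refine integral_congr_ae (.of_forall fun q => ?_)
  simp only [expPair]
  ring_nf
end

section
/- Let μ ∈ (0,1) and u > 0. Then Σ_{n∈ℤ} (n + μ/2) exp(−n(n+μ) u) = (π^{3/2}/u^{3/2}) · Σ_{n∈ℤ} n sin(π μ n) exp(−π² n²/u + μ² u/4). -/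
open HurwitzZeta in
/-- Real form of `HurwitzZeta.hasSum_int_sinKernel`. -/
lemma hasSum_int_sinKernel_real (a : ℝ) {t : ℝ} (ht : 0 < t) :
    HasSum (fun n : ℤ ↦ (n : ℝ) * Real.sin (2 * Real.pi * a * n) *
      Real.exp (-Real.pi * (n : ℝ) ^ 2 * t)) (sinKernel a t) := by
  have h := Complex.hasSum_re (hasSum_int_sinKernel a ht)
  rw [Complex.ofReal_re] at h
  refine h.congr_fun fun n ↦ ?_
  have hexp : Complex.exp (2 * Real.pi * Complex.I * a * n)
      = Complex.exp (((2 * Real.pi * a * n : ℝ) : ℂ) * Complex.I) := by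
    congr 1
    push_cast
    ring
  rw [Complex.re_mul_ofReal, hexp, mul_assoc (-Complex.I), neg_mul Complex.I, Complex.neg_re,
    Complex.I_mul_re, neg_neg, ← Complex.ofReal_intCast, Complex.im_ofReal_mul,
    Complex.exp_ofReal_mul_I_im]

/-- Jacobi transformation for `θ_μ`: for `μ ∈ (0,1)` and `u > 0`,
`Σ_{n∈ℤ} (n + μ/2) exp(−n(n+μ)u)
  = (π^{3/2}/u^{3/2}) Σ_{n∈ℤ} n sin(πμn) exp(−π²n²/u + μ²u/4)`. -/
theorem jacobi_transformation_thetaMu (mu : ℝ) (hmu : mu ∈ Set.Ioo (0:ℝ) 1)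
    (u : ℝ) (hu : 0 < u) :
    ∑' n : ℤ, ((n : ℝ) + mu / 2) * Real.exp (-((n : ℝ) * ((n : ℝ) + mu) * u))
      = Real.pi ^ ((3:ℝ)/2) / u ^ ((3:ℝ)/2) *
          ∑' n : ℤ, (n : ℝ) * Real.sin (Real.pi * mu * (n : ℝ))
            * Real.exp (-(Real.pi ^ 2 * (n : ℝ) ^ 2) / u + mu ^ 2 * u / 4) := by
  have hpi := Real.pi_pos
  have hodd := HurwitzZeta.hasSum_int_oddKernel (mu / 2) (div_pos hu hpi)
  have hsin := hasSum_int_sinKernel_real (mu / 2) (div_pos hpi hu)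
  have hL : ∑' n : ℤ, ((n : ℝ) + mu / 2) * Real.exp (-((n : ℝ) * ((n : ℝ) + mu) * u))
      = Real.exp (mu ^ 2 * u / 4) *
        HurwitzZeta.oddKernel ((mu / 2 : ℝ) : UnitAddCircle) (u / Real.pi) := by
    rw [← hodd.tsum_eq, ← tsum_mul_left]
    refine tsum_congr fun n ↦ ?_
    rw [mul_left_comm, ← Real.exp_add]
    congr 2
    field_simp
    ring
  have hR : ∑' n : ℤ, (n : ℝ) * Real.sin (Real.pi * mu * (n : ℝ))
        * Real.exp (-(Real.pi ^ 2 * (n : ℝ) ^ 2) / u + mu ^ 2 * u / 4)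
      = Real.exp (mu ^ 2 * u / 4) *
        HurwitzZeta.sinKernel ((mu / 2 : ℝ) : UnitAddCircle) (Real.pi / u) := by
    rw [← hsin.tsum_eq, ← tsum_mul_left]
    refine tsum_congr fun n ↦ ?_
    rw [mul_left_comm, ← Real.exp_add]
    congr 2
    · congr 1
      ring
    · ring
  rw [hL, hR, HurwitzZeta.oddKernel_functional_equation, one_div_div,
    Real.div_rpow hu.le hpi.le, one_div_div]
  ring
end

section
/- Let μ ∈ (0,1) and let s ∈ ℂ be such that s² ≠ (1 + 2n/μ)² for every n ∈ ℤ. Then π / ( cos(π μ s) − cos(π μ) ) = −(2/(μ sin(π μ))) · Σ_{n∈ℤ} (1 + 2n/μ) / ( s² − (1 + 2n/μ)² ). -/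
open Filter Topology

/-- The symmetric partial sums of `∑ n ∈ ℤ, 1 / (x + n)` converge to `π cot (π x)`. -/
theorem tendsto_sum_Icc_one_div_add_int {x : ℂ} (hx : x ∈ Complex.integerComplement) :
    Tendsto (fun N : ℕ => ∑ n ∈ Finset.Icc (-(N : ℤ)) (N : ℤ), 1 / (x + (n : ℂ)))
      atTop (𝓝 (Real.pi * Complex.cot (Real.pi * x))) := by
  have partial_sum (N : ℕ) : ∑ n ∈ Finset.Icc (-(N : ℤ)) (N : ℤ), 1 / (x + (n : ℂ)) =
      (∑ j ∈ Finset.range N, cotTerm x j) + 1 / x := by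
    induction N with
    | zero => simp
    | succ N ih =>
      rw [Nat.cast_add, Nat.cast_one, Finset.Icc_succ_succ, Finset.sum_union (by simp),
        Finset.sum_pair (by lia), ih, Finset.sum_range_succ]
      simp only [cotTerm]
      push_cast
      ring
  simp only [partial_sum]
  simpa using (tendsto_logDeriv_euler_cot_sub hx).add_const (1 / x)

theorem Complex.cot_add_cot {u v : ℂ} (hu : sin u ≠ 0) (hv : sin v ≠ 0) :
    cot u + cot v = 2 * sin (u + v) / (cos (u - v) - cos (u + v)) := by
  have hden : cos (u - v) - cos (u + v) = 2 * (sin u * sin v) := by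
    rw [cos_sub, cos_add]
    ring
  rw [hden, sin_add, cot_eq_cos_div_sin, cot_eq_cos_div_sin]
  field_simp
  ring

/-- Mittag-Leffler expansion of the shifted cosine: for `μ ∈ (0,1)` and `s ∈ ℂ` with
`s² ≠ (1 + 2n/μ)²` for every `n ∈ ℤ`,
`π/(cos(πμs) − cos(πμ)) = −(2/(μ sin(πμ))) Σ_{n∈ℤ} (1 + 2n/μ)/(s² − (1 + 2n/μ)²)`,
the sum over `ℤ` being understood as the limit of symmetric partial sums. -/
theorem mittag_leffler_shifted_cosine (mu : ℝ) (hmu : mu ∈ Set.Ioo (0:ℝ) 1)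
    (s : ℂ) (hs : ∀ n : ℤ, s ^ 2 ≠ (((1 + 2 * (n : ℝ) / mu : ℝ) : ℂ)) ^ 2) :
    ∃ l : ℂ,
      Tendsto (fun N : ℕ => ∑ n ∈ Finset.Icc (-(N : ℤ)) (N : ℤ),
          ((1 + 2 * (n : ℝ) / mu : ℝ) : ℂ) / (s ^ 2 - ((1 + 2 * (n : ℝ) / mu : ℝ) : ℂ) ^ 2))
        atTop (𝓝 l) ∧
      (Real.pi : ℂ) / (Complex.cos (Real.pi * mu * s) - (Real.cos (Real.pi * mu) : ℂ))
        = -(2 / (mu * Real.sin (Real.pi * mu) : ℝ)) * l := by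
  obtain ⟨hmu0, hmu1⟩ := hmu
  have hm : (mu : ℂ) ≠ 0 := by exact_mod_cast hmu0.ne'
  have hsin : Complex.sin (Real.pi * mu) ≠ 0 := by
    exact_mod_cast (Real.sin_pos_of_pos_of_lt_pi (by positivity)
      (by nlinarith [Real.pi_pos])).ne'
  have hx : (mu * (1 - s) / 2 : ℂ) ∈ Complex.integerComplement := by
    rintro ⟨n, hn⟩
    apply hs (-n)
    have : s = 1 + 2 * (-n) / mu := by
      rw [hn]
      field_simp
      ring
    rw [this]
    push_cast
    ring
  have hy : (mu * (1 + s) / 2 : ℂ) ∈ Complex.integerComplement := by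
    rintro ⟨n, hn⟩
    apply hs (-n)
    have : s = -(1 + 2 * (-n) / mu) := by
      rw [hn]
      field_simp
      ring
    rw [this]
    push_cast
    ring
  refine ⟨_, (((tendsto_sum_Icc_one_div_add_int hx).add
    (tendsto_sum_Icc_one_div_add_int hy)).const_mul (-(mu / 4 : ℂ))).congr fun N => ?_, ?_⟩
  · rw [← Finset.sum_add_distrib, Finset.mul_sum]
    refine Finset.sum_congr rfl fun n _ => ?_
    have hxn := Complex.integerComplement_add_ne_zero hx n
    have hyn := Complex.integerComplement_add_ne_zero hy n
    have hprod : s ^ 2 - ((1 + 2 * (n : ℝ) / mu : ℝ) : ℂ) ^ 2 =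
        -(4 / mu ^ 2) * ((mu * (1 - s) / 2 + n) * (mu * (1 + s) / 2 + n)) := by
      push_cast
      field_simp
      ring
    have hsum : ((1 + 2 * (n : ℝ) / mu : ℝ) : ℂ) =
        (1 / mu) * ((mu * (1 - s) / 2 + n) + (mu * (1 + s) / 2 + n)) := by
      push_cast
      field_simp
      ring
    rw [hprod, hsum]
    generalize (mu * (1 - s) / 2 + n : ℂ) = a at *
    generalize (mu * (1 + s) / 2 + n : ℂ) = b at *
    field_simp
    ring
  · rw [← mul_add, Complex.cot_add_cot (sin_pi_mul_ne_zero hx) (sin_pi_mul_ne_zero hy)]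
    have hadd : (Real.pi * (mu * (1 - s) / 2) + Real.pi * (mu * (1 + s) / 2) : ℂ) =
        Real.pi * mu := by ring
    have hsub : (Real.pi * (mu * (1 - s) / 2) - Real.pi * (mu * (1 + s) / 2) : ℂ) =
        -(Real.pi * mu * s) := by ring
    rw [hadd, hsub, Complex.cos_neg]
    push_cast
    field_simp
    ring
end

section
/- Let λ1 and λ2 be real numbers and let x, y be real numbers with (x − y)² + λ1 x + λ2 y = 0. Then (2x − y) · y (y + λ2)(y + 2λ1 + λ2) = (2y − x) · x (x + λ1)(x + 2λ2 + λ1). -/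
/-- On the zero set of the kernel `K(x,y) = (x-y)^2 + λ1*x + λ2*y`, one has
`(2x - y) D1(y) = (2y - x) D2(x)` where `D1(y) = y(y+λ2)(y+2λ1+λ2)` and
`D2(x) = x(x+λ1)(x+2λ2+λ1)`. -/
theorem decoupling_on_kernel (l1 l2 : ℝ) (x y : ℝ)
    (hK : (x - y) ^ 2 + l1 * x + l2 * y = 0) :
    (2 * x - y) * (y * (y + l2) * (y + 2 * l1 + l2))
      = (2 * y - x) * (x * (x + l1) * (x + 2 * l2 + l1)) := by
  linear_combination (l1 * (x - 2 * y) + l2 * (2 * x - y) + x ^ 2 - y ^ 2) * hK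
end

section
/- Let λ1 > 0, λ2 > 0 and define W(y) = cosh²( π √( y/(λ1+λ2) − λ1²/(4(λ1+λ2)²) ) ) for complex y, using the principal branch of the complex square root. Then W restricted to the open region D2 = { y ∈ ℂ : (Im y)² < (λ1+λ2) Re y + (1/4) λ2 (2λ1+λ2) } is an analytic bijection from D2 onto the slit plane ℂ ∖ (−∞, 0], whose inverse W⁻¹(z) = λ1²/(4(λ1+λ2)) + ((λ1+λ2)/π²) · ( log(√z − √(z−1)) )² is analytic on ℂ ∖ (−∞, 0]; moreover, for every y on the boundary parabola P2 = { y ∈ ℂ : (Im y)² = (λ1+λ2) Re y + (1/4) λ2 (2λ1+λ2) } one has W(y) = W(ȳ) ∈ (−∞, 0]. -/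
open Complex

/-- The conformal gluing function
`W(y) = cosh²(π √(y/(λ1+λ2) − λ1²/(4(λ1+λ2)²)))` (principal complex square root). -/
noncomputable def Wmap (l1 l2 : ℝ) (y : ℂ) : ℂ :=
  Complex.cosh ((Real.pi : ℂ) *
    ((y / ((l1 : ℂ) + l2) - (l1 : ℂ) ^ 2 / (4 * ((l1 : ℂ) + l2) ^ 2)) ^ (1/2 : ℂ))) ^ 2

/-- Its inverse `W⁻¹(z) = λ1²/(4(λ1+λ2)) + ((λ1+λ2)/π²) (log(√z − √(z−1)))²`
(principal branches). -/
noncomputable def WmapInv (l1 l2 : ℝ) (z : ℂ) : ℂ :=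
  (l1 : ℂ) ^ 2 / (4 * ((l1 : ℂ) + l2)) +
    (((l1 : ℂ) + l2) / (Real.pi : ℂ) ^ 2) *
      (Complex.log (z ^ (1/2 : ℂ) - (z - 1) ^ (1/2 : ℂ))) ^ 2

theorem cpow_half_sq (u : ℂ) : (u ^ (1/2 : ℂ)) ^ 2 = u := by
  rw [one_div]
  exact_mod_cast Complex.cpow_nat_inv_pow u two_ne_zero

theorem re_cpow_half_nonneg (u : ℂ) : 0 ≤ (u ^ (1/2 : ℂ)).re := by
  rcases eq_or_ne u 0 with rfl | hu
  · simp
  rw [Complex.cpow_def_of_ne_zero hu, Complex.exp_re]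
  have him : (Complex.log u * (1/2 : ℂ)).im = u.arg / 2 := by
    rw [show (1/2 : ℂ) = ((1/2 : ℝ) : ℂ) by push_cast; rfl, Complex.im_mul_ofReal,
      Complex.log_im]
    ring
  rw [him]
  refine mul_nonneg (Real.exp_pos _).le (Real.cos_nonneg_of_mem_Icc ⟨?_, ?_⟩)
  · linarith [Complex.neg_pi_lt_arg u]
  · linarith [Complex.arg_le_pi u]

theorem cpow_half_sq_of_re_pos {w : ℂ} (hw : 0 < w.re) : (w ^ 2) ^ (1/2 : ℂ) = w := by
  rcases sq_eq_sq_iff_eq_or_eq_neg.1 (cpow_half_sq (w ^ 2)) with h | h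
  · exact h
  · have := re_cpow_half_nonneg (w ^ 2)
    rw [h, Complex.neg_re] at this
    linarith

theorem re_cpow_half_pos {z : ℂ} (hz : z ∈ slitPlane) : 0 < (z ^ (1/2 : ℂ)).re := by
  refine lt_of_le_of_ne (re_cpow_half_nonneg z) fun h => ?_
  have hsq := cpow_half_sq z
  set p := z ^ (1/2 : ℂ)
  rw [← hsq, Complex.mem_slitPlane_iff] at hz
  simp only [sq, Complex.mul_re, Complex.mul_im, ← h] at hz
  rcases hz with hz | hz
  · nlinarith [mul_self_nonneg p.im]
  · simp at hz

theorem cosh_sq_eq_of_sq_eq {s t : ℂ} (h : s ^ 2 = t ^ 2) :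
    Complex.cosh (Real.pi * s) ^ 2 = Complex.cosh (Real.pi * t) ^ 2 := by
  rcases sq_eq_sq_iff_eq_or_eq_neg.1 h with rfl | rfl
  · rfl
  · rw [mul_neg, Complex.cosh_neg]

theorem differentiableAt_cpow_half {z : ℂ} (hz : z ∈ slitPlane) :
    DifferentiableAt ℂ (fun z : ℂ => z ^ (1/2 : ℂ)) z :=
  DifferentiableAt.cpow_const differentiableAt_id hz

theorem continuousAt_cpow_half_zero : ContinuousAt (fun z : ℂ => z ^ (1/2 : ℂ)) 0 :=
  Complex.continuousAt_cpow_const_of_re_pos (.inl le_rfl) (by norm_num)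

/-- The function `u ↦ cosh² (π √u)` is entire, although `√` is not. -/
theorem differentiable_cosh_cpow_half_sq :
    Differentiable ℂ fun u : ℂ => Complex.cosh (Real.pi * u ^ (1/2 : ℂ)) ^ 2 := by
  have hne : ∀ u : ℂ, u ≠ 0 →
      DifferentiableAt ℂ (fun u : ℂ => Complex.cosh (Real.pi * u ^ (1/2 : ℂ)) ^ 2) u := by
    intro u hu
    rcases mem_slitPlane_or_neg_mem_slitPlane hu with h | h
    · exact (((differentiableAt_cpow_half h).const_mul _).ccosh).pow 2
    · have heq : (fun u : ℂ => Complex.cosh (Real.pi * u ^ (1/2 : ℂ)) ^ 2) =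
          fun u : ℂ => Complex.cosh (Real.pi * (I * (-u) ^ (1/2 : ℂ))) ^ 2 := by
        funext v
        apply cosh_sq_eq_of_sq_eq
        rw [mul_pow, cpow_half_sq, cpow_half_sq, Complex.I_sq]
        ring
      rw [heq]
      have hd : DifferentiableAt ℂ (fun u : ℂ => (-u) ^ (1/2 : ℂ)) u :=
        DifferentiableAt.cpow_const differentiableAt_id.neg h
      exact (((hd.const_mul I).const_mul _).ccosh).pow 2
  rw [← differentiableOn_univ]
  refine (Complex.differentiableOn_compl_singleton_and_continuousAt_iff
    (c := (0 : ℂ)) Filter.univ_mem).1 ⟨fun u hu => (hne u hu.2).differentiableWithinAt, ?_⟩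
  exact ((Complex.continuous_cosh.continuousAt.comp
    (continuousAt_const.mul continuousAt_cpow_half_zero)).pow 2)

theorem re_inv_pos {w : ℂ} (hw : 0 < w.re) : 0 < (w⁻¹).re := by
  rw [Complex.inv_re]
  exact div_pos hw (Complex.normSq_pos.2 fun h => by simp [h] at hw)

/-- If `q` is a square root of `z - 1`, then `√z - q` lies in the right half-plane. -/
theorem re_cpow_half_sub_pos {z q : ℂ} (hz : z ∈ slitPlane) (hq : q ^ 2 = z - 1) :
    0 < (z ^ (1/2 : ℂ) - q).re := by
  have hp := re_cpow_half_pos hz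
  have hsq := cpow_half_sq z
  set p := z ^ (1/2 : ℂ)
  have hmul : (p - q) * (p + q) = 1 := by linear_combination hsq - hq
  rcases le_total q.re 0 with h | h
  · rw [Complex.sub_re]; linarith
  · rw [eq_inv_of_mul_eq_one_left hmul]
    apply re_inv_pos
    rw [Complex.add_re]; linarith

theorem log_cpow_half_add {z q : ℂ} (hz : z ∈ slitPlane) (hq : q ^ 2 = z - 1) :
    Complex.log (z ^ (1/2 : ℂ) + q) = -Complex.log (z ^ (1/2 : ℂ) - q) := by
  have hpos := re_cpow_half_sub_pos hz hq
  have hmul : (z ^ (1/2 : ℂ) + q) * (z ^ (1/2 : ℂ) - q) = 1 := by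
    linear_combination cpow_half_sq z - hq
  rw [eq_inv_of_mul_eq_one_left hmul, Complex.log_inv]
  exact Complex.slitPlane_arg_ne_pi (.inl hpos)

theorem log_cpow_half_sub_sq_congr {z q r : ℂ} (hz : z ∈ slitPlane) (hq : q ^ 2 = z - 1)
    (hr : r ^ 2 = z - 1) :
    Complex.log (z ^ (1/2 : ℂ) - q) ^ 2 = Complex.log (z ^ (1/2 : ℂ) - r) ^ 2 := by
  rcases sq_eq_sq_iff_eq_or_eq_neg.1 (hq.trans hr.symm) with rfl | rfl
  · rfl
  · rw [sub_neg_eq_add, log_cpow_half_add hz hr, neg_sq]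

/-- The function `z ↦ log² (√z - √(z - 1))` is analytic across the cut `(0, 1]` of `√(z - 1)`. -/
theorem differentiableOn_log_cpow_half_sub_sq :
    DifferentiableOn ℂ
      (fun z : ℂ => Complex.log (z ^ (1/2 : ℂ) - (z - 1) ^ (1/2 : ℂ)) ^ 2) slitPlane := by
  have hmem : ∀ z ∈ slitPlane, z ^ (1/2 : ℂ) - (z - 1) ^ (1/2 : ℂ) ∈ slitPlane :=
    fun z hz => .inl (re_cpow_half_sub_pos hz (cpow_half_sq _))
  have hne : ∀ z ∈ slitPlane, z ≠ 1 → DifferentiableAt ℂ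
      (fun z : ℂ => Complex.log (z ^ (1/2 : ℂ) - (z - 1) ^ (1/2 : ℂ)) ^ 2) z := by
    intro z hz hz1
    rcases mem_slitPlane_or_neg_mem_slitPlane (sub_ne_zero.2 hz1) with h | h
    · have hd : DifferentiableAt ℂ (fun z : ℂ => (z - 1) ^ (1/2 : ℂ)) z :=
        DifferentiableAt.cpow_const (differentiableAt_id.sub_const 1) h
      exact (((differentiableAt_cpow_half hz).sub hd).clog (hmem z hz)).pow 2
    · have hroot : ∀ v : ℂ, (I * (-(v - 1)) ^ (1/2 : ℂ)) ^ 2 = v - 1 := fun v => by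
        rw [mul_pow, cpow_half_sq, Complex.I_sq]
        ring
      have hd : DifferentiableAt ℂ (fun z : ℂ => (-(z - 1)) ^ (1/2 : ℂ)) z :=
        DifferentiableAt.cpow_const (differentiableAt_id.sub_const 1).neg h
      have hd' : DifferentiableAt ℂ
          (fun z : ℂ => Complex.log (z ^ (1/2 : ℂ) - I * (-(z - 1)) ^ (1/2 : ℂ)) ^ 2) z :=
        (((differentiableAt_cpow_half hz).sub (hd.const_mul I)).clog
          (.inl (re_cpow_half_sub_pos hz (hroot z)))).pow 2
      refine hd'.congr_of_eventuallyEq ?_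
      filter_upwards [Complex.isOpen_slitPlane.mem_nhds hz] with v hv
      exact log_cpow_half_sub_sq_congr hv (cpow_half_sq _) (hroot v)
  have hone : (1 : ℂ) ∈ slitPlane := Complex.one_mem_slitPlane
  refine (Complex.differentiableOn_compl_singleton_and_continuousAt_iff
    (c := (1 : ℂ)) (Complex.isOpen_slitPlane.mem_nhds hone)).1
    ⟨fun z hz => (hne z hz.1 hz.2).differentiableWithinAt, ?_⟩
  have hc : ContinuousAt (fun z : ℂ => (z - 1) ^ (1/2 : ℂ)) 1 :=
    ContinuousAt.comp (g := fun z : ℂ => z ^ (1/2 : ℂ)) (f := fun z : ℂ => z - 1)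
      (by simpa using continuousAt_cpow_half_zero) (by fun_prop)
  exact (((differentiableAt_cpow_half hone).continuousAt.sub hc).clog (hmem 1 hone)).pow 2

theorem re_sq_add_sub_im_sq_sq (s : ℂ) :
    (s ^ 2).re + 1/4 - (s ^ 2).im ^ 2 = (s.re ^ 2 + 1/4) * (1 - 4 * s.im ^ 2) := by
  simp only [sq, Complex.mul_re, Complex.mul_im]
  ring

theorem cosh_pi_mul_re (s : ℂ) : (Complex.cosh (Real.pi * s)).re =
    Real.cosh (Real.pi * s.re) * Real.cos (Real.pi * s.im) := by
  conv_lhs => rw [← Complex.re_add_im s, mul_add, ← mul_assoc, Complex.cosh_add, Complex.cosh_mul_I,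
    Complex.sinh_mul_I]
  rw [← Complex.ofReal_mul, ← Complex.ofReal_mul, ← Complex.ofReal_cosh, ← Complex.ofReal_sinh,
    ← Complex.ofReal_cos, ← Complex.ofReal_sin, Complex.add_re, Complex.re_ofReal_mul,
    Complex.re_ofReal_mul, Complex.re_ofReal_mul, Complex.I_re, Complex.ofReal_re]
  ring

theorem re_cosh_pi_mul_pos {s : ℂ} (hs : |s.im| < 1/2) :
    0 < (Complex.cosh (Real.pi * s)).re := by
  rw [cosh_pi_mul_re]
  have h := abs_lt.1 hs
  refine mul_pos (Real.cosh_pos _) (Real.cos_pos_of_mem_Ioo ⟨?_, ?_⟩) <;>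
    nlinarith [Real.pi_pos, h.1, h.2]

theorem sq_mem_slitPlane {w : ℂ} (hw : 0 < w.re) : w ^ 2 ∈ slitPlane := by
  rw [Complex.mem_slitPlane_iff]
  simp only [sq, Complex.mul_re, Complex.mul_im]
  by_cases h : w.im = 0
  · left; rw [h]; nlinarith
  · right
    have : w.re * w.im ≠ 0 := mul_ne_zero hw.ne' h
    intro h0
    apply this
    linarith

/-- On the strip `|Im s| < 1/2` the logarithmic formula inverts `s² ↦ cosh² (π s)`. -/
theorem log_cosh_sq {s : ℂ} (hs : |s.im| < 1/2) :
    Complex.log ((Complex.cosh (Real.pi * s) ^ 2) ^ (1/2 : ℂ) -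
      (Complex.cosh (Real.pi * s) ^ 2 - 1) ^ (1/2 : ℂ)) ^ 2 = (Real.pi * s) ^ 2 := by
  have hpos := re_cosh_pi_mul_pos hs
  have hsinh : Complex.sinh (Real.pi * s) ^ 2 = Complex.cosh (Real.pi * s) ^ 2 - 1 :=
    Complex.sinh_sq _
  rw [log_cpow_half_sub_sq_congr (sq_mem_slitPlane hpos) (cpow_half_sq _) hsinh,
    cpow_half_sq_of_re_pos hpos, Complex.cosh_sub_sinh, Complex.log_exp, neg_sq]
  all_goals
    have h := abs_lt.1 hs
    rw [Complex.neg_im, Complex.im_ofReal_mul]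
    nlinarith [Real.pi_pos, h.1, h.2]

/-- `s ↦ cosh² (π s)` maps the strip `|Im s| < 1/2` onto the slit plane. -/
theorem exists_strip_cosh_sq_eq {z : ℂ} (hz : z ∈ slitPlane) :
    ∃ s : ℂ, |s.im| < 1/2 ∧ Complex.cosh (Real.pi * s) ^ 2 = z := by
  set q := (z - 1) ^ (1/2 : ℂ)
  have hq : q ^ 2 = z - 1 := cpow_half_sq _
  have hpos := re_cpow_half_sub_pos hz hq
  have hne : z ^ (1/2 : ℂ) - q ≠ 0 := fun h => by
    rw [h] at hpos
    exact lt_irrefl _ hpos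
  have hpi : (Real.pi : ℂ) ≠ 0 := Complex.ofReal_ne_zero.2 Real.pi_ne_zero
  refine ⟨Complex.log (z ^ (1/2 : ℂ) - q) / Real.pi, ?_, ?_⟩
  · rw [Complex.div_ofReal_im, Complex.log_im, abs_div, abs_of_pos Real.pi_pos,
      div_lt_iff₀ Real.pi_pos]
    linarith [Complex.abs_arg_lt_pi_div_two_iff.2 (.inl hpos)]
  · have hinv : (z ^ (1/2 : ℂ) - q)⁻¹ = z ^ (1/2 : ℂ) + q :=
      inv_eq_of_mul_eq_one_right (by linear_combination cpow_half_sq z - hq)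
    rw [mul_div_cancel₀ _ hpi, Complex.cosh, Complex.exp_neg, Complex.exp_log hne, hinv]
    linear_combination cpow_half_sq z

/-- The affine change of variable under which the parabola becomes `(Im u)² = Re u + 1/4`. -/
noncomputable def affineCoord (l1 l2 : ℝ) (y : ℂ) : ℂ :=
  y / ((l1 : ℂ) + l2) - (l1 : ℂ) ^ 2 / (4 * ((l1 : ℂ) + l2) ^ 2)

theorem Wmap_eq_of_sq_eq {l1 l2 : ℝ} {y s : ℂ} (h : s ^ 2 = affineCoord l1 l2 y) :
    Wmap l1 l2 y = Complex.cosh (Real.pi * s) ^ 2 :=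
  cosh_sq_eq_of_sq_eq ((cpow_half_sq _).trans h.symm)

theorem parabola_eq {l1 l2 : ℝ} (hl : 0 < l1 + l2) {y s : ℂ} (h : s ^ 2 = affineCoord l1 l2 y) :
    (l1 + l2) * y.re + (1/4) * l2 * (2 * l1 + l2) - y.im ^ 2 =
      (l1 + l2) ^ 2 * ((s.re ^ 2 + 1/4) * (1 - 4 * s.im ^ 2)) := by
  have hu : affineCoord l1 l2 y =
      y / ((l1 + l2 : ℝ) : ℂ) - ((l1 ^ 2 / (4 * (l1 + l2) ^ 2) : ℝ) : ℂ) := by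
    rw [affineCoord]; push_cast; rfl
  rw [← re_sq_add_sub_im_sq_sq, h, hu, Complex.sub_re, Complex.sub_im, Complex.div_ofReal_re,
    Complex.div_ofReal_im, Complex.ofReal_re, Complex.ofReal_im]
  field_simp
  ring

theorem affineCoord_affine {l1 l2 : ℝ} (hl : 0 < l1 + l2) (u : ℂ) :
    affineCoord l1 l2 ((l1 : ℂ) ^ 2 / (4 * ((l1 : ℂ) + l2)) + ((l1 : ℂ) + l2) * u) = u := by
  have : (l1 : ℂ) + l2 ≠ 0 := by exact_mod_cast hl.ne'
  rw [affineCoord]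
  field_simp
  ring

theorem affine_affineCoord {l1 l2 : ℝ} (hl : 0 < l1 + l2) (y : ℂ) :
    (l1 : ℂ) ^ 2 / (4 * ((l1 : ℂ) + l2)) + ((l1 : ℂ) + l2) * affineCoord l1 l2 y = y := by
  have : (l1 : ℂ) + l2 ≠ 0 := by exact_mod_cast hl.ne'
  rw [affineCoord]
  field_simp
  ring

theorem parabola_interior_iff {l1 l2 : ℝ} (hl : 0 < l1 + l2) {y s : ℂ}
    (h : s ^ 2 = affineCoord l1 l2 y) :
    y.im ^ 2 < (l1 + l2) * y.re + (1/4) * l2 * (2 * l1 + l2) ↔ |s.im| < 1/2 := by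
  rw [← sub_pos, parabola_eq hl h, mul_pos_iff_of_pos_left (pow_pos hl 2),
    mul_pos_iff_of_pos_left (add_pos_of_nonneg_of_pos (sq_nonneg _) (by norm_num)),
    ← sq_lt_sq₀ (abs_nonneg s.im) (by norm_num), sq_abs]
  constructor <;> intro <;> linarith

theorem WmapInv_Wmap {l1 l2 : ℝ} (hl : 0 < l1 + l2) {y : ℂ}
    (hy : y.im ^ 2 < (l1 + l2) * y.re + (1/4) * l2 * (2 * l1 + l2)) :
    WmapInv l1 l2 (Wmap l1 l2 y) = y := by
  have hs := cpow_half_sq (affineCoord l1 l2 y)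
  have hpi : (Real.pi : ℂ) ≠ 0 := Complex.ofReal_ne_zero.2 Real.pi_ne_zero
  rw [WmapInv, Wmap_eq_of_sq_eq hs, log_cosh_sq ((parabola_interior_iff hl hs).1 hy), mul_pow, hs,
    ← mul_assoc, div_mul_cancel₀ _ (pow_ne_zero 2 hpi), affine_affineCoord hl]

theorem Wmap_mem_slitPlane {l1 l2 : ℝ} (hl : 0 < l1 + l2) {y : ℂ}
    (hy : y.im ^ 2 < (l1 + l2) * y.re + (1/4) * l2 * (2 * l1 + l2)) :
    Wmap l1 l2 y ∈ slitPlane := by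
  have hs := cpow_half_sq (affineCoord l1 l2 y)
  rw [Wmap_eq_of_sq_eq hs]
  exact sq_mem_slitPlane (re_cosh_pi_mul_pos ((parabola_interior_iff hl hs).1 hy))

theorem affineCoord_conj (l1 l2 : ℝ) (y : ℂ) :
    affineCoord l1 l2 ((starRingEnd ℂ) y) = (starRingEnd ℂ) (affineCoord l1 l2 y) := by
  simp [affineCoord, Complex.conj_ofNat]

theorem Wmap_conj (l1 l2 : ℝ) (y : ℂ) :
    Wmap l1 l2 ((starRingEnd ℂ) y) = (starRingEnd ℂ) (Wmap l1 l2 y) := by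
  have hs := cpow_half_sq (affineCoord l1 l2 y)
  have hs' : ((starRingEnd ℂ) (affineCoord l1 l2 y ^ (1/2 : ℂ))) ^ 2 =
      affineCoord l1 l2 ((starRingEnd ℂ) y) := by
    rw [← map_pow, hs, affineCoord_conj]
  rw [Wmap_eq_of_sq_eq hs, Wmap_eq_of_sq_eq hs', map_pow, ← Complex.cosh_conj, map_mul,
    Complex.conj_ofReal]

theorem Wmap_boundary {l1 l2 : ℝ} (hl : 0 < l1 + l2) {y : ℂ}
    (hy : y.im ^ 2 = (l1 + l2) * y.re + (1/4) * l2 * (2 * l1 + l2)) :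
    (Wmap l1 l2 y).im = 0 ∧ (Wmap l1 l2 y).re ≤ 0 := by
  have hs := cpow_half_sq (affineCoord l1 l2 y)
  rw [Wmap_eq_of_sq_eq hs]
  have heq := parabola_eq hl hs
  set s := affineCoord l1 l2 y ^ (1/2 : ℂ)
  have him : s.im ^ 2 = (1/2) ^ 2 := by
    rw [hy, sub_self, eq_comm, mul_eq_zero, mul_eq_zero] at heq
    rcases heq with h | h | h
    · exact absurd h (by positivity)
    · exact absurd h (by positivity)
    · linarith
  have hre : (Complex.cosh (Real.pi * s)).re = 0 := by
    rw [cosh_pi_mul_re]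
    rcases sq_eq_sq_iff_eq_or_eq_neg.1 him with h | h <;> rw [h]
    · rw [mul_one_div, Real.cos_pi_div_two, mul_zero]
    · rw [mul_neg, Real.cos_neg, mul_one_div, Real.cos_pi_div_two, mul_zero]
  simp only [sq, Complex.mul_re, Complex.mul_im, hre]
  constructor
  · ring
  · nlinarith [mul_self_nonneg (Complex.cosh (Real.pi * s)).im]

/-- Lemma (conformal gluing function): for `λ1, λ2 > 0`, `W` is an analytic bijection from
the open region `D2` inside the parabola `P2` onto the slit plane `ℂ ∖ (−∞,0]`, whose
inverse `W⁻¹` is analytic on the slit plane; moreover, for `y` on the boundary parabola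
`P2` one has `W(y) = W(ȳ) ∈ (−∞,0]`. -/
theorem conformal_gluing (l1 l2 : ℝ) (hl1 : 0 < l1) (hl2 : 0 < l2)
    (D2 : Set ℂ)
    (hD2 : D2 = {y : ℂ | y.im ^ 2 < (l1 + l2) * y.re + (1/4) * l2 * (2 * l1 + l2)})
    (P2 : Set ℂ)
    (hP2 : P2 = {y : ℂ | y.im ^ 2 = (l1 + l2) * y.re + (1/4) * l2 * (2 * l1 + l2)})
    (slit : Set ℂ) (hslit : slit = {z : ℂ | z.im ≠ 0 ∨ 0 < z.re}) :
    Set.BijOn (Wmap l1 l2) D2 slit ∧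
    DifferentiableOn ℂ (Wmap l1 l2) D2 ∧
    DifferentiableOn ℂ (WmapInv l1 l2) slit ∧
    (∀ y ∈ D2, WmapInv l1 l2 (Wmap l1 l2 y) = y) ∧
    (∀ y ∈ P2, Wmap l1 l2 y = Wmap l1 l2 ((starRingEnd ℂ) y) ∧
      (Wmap l1 l2 y).im = 0 ∧ (Wmap l1 l2 y).re ≤ 0) := by
  have hl : 0 < l1 + l2 := add_pos hl1 hl2
  have hslit' : slit = slitPlane := by
    rw [hslit]
    ext z
    rw [Set.mem_ofPred_eq, Complex.mem_slitPlane_iff, or_comm]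
  subst hslit' hD2 hP2
  have hinv : ∀ y ∈ {y : ℂ | y.im ^ 2 < (l1 + l2) * y.re + (1/4) * l2 * (2 * l1 + l2)},
      WmapInv l1 l2 (Wmap l1 l2 y) = y := fun y hy => WmapInv_Wmap hl hy
  refine ⟨⟨fun y hy => Wmap_mem_slitPlane hl hy, Set.LeftInvOn.injOn hinv, fun z hz => ?_⟩,
    ?_, ?_, hinv, fun y hy => ?_⟩
  · obtain ⟨s, hs, rfl⟩ := exists_strip_cosh_sq_eq hz
    have h := (affineCoord_affine hl (s ^ 2)).symm
    exact ⟨_, (parabola_interior_iff hl h).2 hs, Wmap_eq_of_sq_eq h⟩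
  · exact (differentiable_cosh_cpow_half_sq.comp
      ((differentiable_id.div_const _).sub_const _)).differentiableOn
  · exact (differentiableOn_log_cpow_half_sub_sq.const_mul _).const_add _
  · obtain ⟨him, hre⟩ := Wmap_boundary hl hy
    exact ⟨by rw [Wmap_conj, Complex.conj_eq_iff_im.2 him], him, hre⟩
end

section
/- Let λ1 > 0, λ2 > 0 and define A1^+(y) = −λ1/2 + y + √( λ1²/4 − (λ1+λ2) y ) for complex y, using the principal branch of the complex square root. Then every y in the region D2 = { y ∈ ℂ : (Im y)² < (λ1+λ2) Re y + (1/4) λ2 (2λ1+λ2) } with Re y < 0 satisfies Re A1^+(y) > 0; consequently D2 is contained in the set S = { y ∈ ℂ : Re y ≥ 0 or Re A1^+(y) > 0 }. -/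
open Complex

/-- The branch `A1^+(y) = −λ1/2 + y + √(λ1²/4 − (λ1+λ2)y)` (principal complex square root). -/
noncomputable def A1plus (l1 l2 : ℝ) (y : ℂ) : ℂ :=
  -(l1 : ℂ) / 2 + y + ((l1 : ℂ) ^ 2 / 4 - ((l1 : ℂ) + l2) * y) ^ (1/2 : ℂ)

/-- On the strip `-l2 < Re y < 0`, the branch `A1plus` has positive real part. -/
theorem A1plus_re_pos {l1 l2 : ℝ} {y : ℂ} (hy : -l2 < y.re)
    (hy0 : y.re < 0) : 0 < (A1plus l1 l2 y).re := by
  set w : ℂ := (l1 : ℂ) ^ 2 / 4 - ((l1 : ℂ) + l2) * y with hw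
  have hwre : w.re = l1 ^ 2 / 4 - (l1 + l2) * y.re := by
    have : (l1 : ℂ) ^ 2 / 4 = ((l1 ^ 2 / 4 : ℝ) : ℂ) := by push_cast; rfl
    rw [hw, this, ← ofReal_add, sub_re, re_ofReal_mul, ofReal_re]
  have hA : (A1plus l1 l2 y).re = -l1 / 2 + y.re + √((‖w‖ + w.re) / 2) := by
    have : -(l1 : ℂ) / 2 = ((-l1 / 2 : ℝ) : ℂ) := by push_cast; rfl
    rw [A1plus, ← hw, one_div, add_re, add_re, cpow_inv_two_re, this, ofReal_re]
  have hsqrt : l1 / 2 - y.re < √((‖w‖ + w.re) / 2) := by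
    apply Real.lt_sqrt_of_sq_lt
    have := re_le_norm w
    nlinarith [mul_pos (neg_pos.2 hy0) (neg_lt_iff_pos_add.1 hy)]
  rw [hA]
  linarith

/-- For `λ1, λ2 > 0`, every `y` in the region `D2` inside the parabola with `Re y < 0`
satisfies `Re A1^+(y) > 0`; consequently `D2 ⊆ S = {y : Re y ≥ 0 or Re A1^+(y) > 0}`. -/
theorem D2_subset_S (l1 l2 : ℝ) (hl1 : 0 < l1) (hl2 : 0 < l2)
    (D2 : Set ℂ)
    (hD2 : D2 = {y : ℂ | y.im ^ 2 < (l1 + l2) * y.re + (1/4) * l2 * (2 * l1 + l2)})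
    (S : Set ℂ) (hS : S = {y : ℂ | 0 ≤ y.re ∨ 0 < (A1plus l1 l2 y).re}) :
    (∀ y ∈ D2, y.re < 0 → 0 < (A1plus l1 l2 y).re) ∧ D2 ⊆ S := by
  have key : ∀ y ∈ D2, y.re < 0 → 0 < (A1plus l1 l2 y).re := by
    intro y hy hy0
    rw [hD2, Set.mem_ofPred_eq] at hy
    refine A1plus_re_pos ?_ hy0
    by_contra! h
    nlinarith [sq_nonneg y.im, mul_pos hl1 hl2]
  refine ⟨key, fun y hy => ?_⟩
  rw [hS]
  exact (le_or_gt 0 y.re).imp_right (key y hy)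
end

section
/- Let λ1 > 0, λ2 > 0, set a_0 = 4λ1 + 6λ2 and b_0 = 2λ1 + 4λ2, and define for n ≥ 0: a_{2n} = a_0 + 2n(a_0 − b_0) + n² λ1 + n(n+1) λ2, b_{2n} = b_0 + 2n(a_0 − b_0) + n(n−1) λ1 + n² λ2, a_{2n+1} = a_{2n}, and b_{2n+1} = b_{2n+2}. Then for every n ≥ 0, (a_n − b_n)² − λ1 a_n − λ2 b_n = 0. -/
/-- The exponent sequence `a_n` of the compensation approach:
`a_0 = 4λ1+6λ2`, `a_{2m} = a_0 + 2m(a_0−b_0) + m²λ1 + m(m+1)λ2`, `a_{2m+1} = a_{2m}`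
(with `b_0 = 2λ1+4λ2`); since `a_{2m+1} = a_{2m}`, it only depends on `m = n/2`. -/
noncomputable def aSeq (l1 l2 : ℝ) (n : ℕ) : ℝ :=
  let a0 : ℝ := 4 * l1 + 6 * l2
  let b0 : ℝ := 2 * l1 + 4 * l2
  let m : ℝ := ((n / 2 : ℕ) : ℝ)
  a0 + 2 * m * (a0 - b0) + m ^ 2 * l1 + m * (m + 1) * l2

/-- The exponent sequence `b_n`:
`b_0 = 2λ1+4λ2`, `b_{2m} = b_0 + 2m(a_0−b_0) + m(m−1)λ1 + m²λ2`, `b_{2m+1} = b_{2m+2}`. -/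
noncomputable def bSeq (l1 l2 : ℝ) (n : ℕ) : ℝ :=
  let a0 : ℝ := 4 * l1 + 6 * l2
  let b0 : ℝ := 2 * l1 + 4 * l2
  let m : ℝ := if Even n then ((n / 2 : ℕ) : ℝ) else ((n / 2 : ℕ) : ℝ) + 1
  b0 + 2 * m * (a0 - b0) + m * (m - 1) * l1 + m ^ 2 * l2

/-- The points `(a_n, b_n)` produced by the compensation approach all lie on the parabola
`K*(a,b) = (a−b)² − λ1 a − λ2 b = 0`. -/
theorem compensation_exponents_on_parabola (l1 l2 : ℝ) (hl1 : 0 < l1) (hl2 : 0 < l2) :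
    ∀ n : ℕ, (aSeq l1 l2 n - bSeq l1 l2 n) ^ 2 - l1 * aSeq l1 l2 n - l2 * bSeq l1 l2 n = 0 := by
  intro n
  simp only [aSeq, bSeq]
  split_ifs <;> ring
end

section
/- Let λ1 > 0, λ2 > 0, μ2 = λ2/(λ1+λ2), and let (a_n, b_n) be defined by a_0 = 4λ1+6λ2, b_0 = 2λ1+4λ2, a_{2n} = a_0 + 2n(a_0−b_0) + n² λ1 + n(n+1) λ2, b_{2n} = b_0 + 2n(a_0−b_0) + n(n−1) λ1 + n² λ2, a_{2n+1} = a_{2n}, b_{2n+1} = b_{2n+2}. Define (c_n) by c_0 = 1 and the recursion c_{2n+1} = −c_{2n} (3a_{2n} − 2b_{2n} + 2λ2)/(3a_{2n+1} − 2b_{2n+1} + 2λ2) and c_{2n+2} = −c_{2n+1} (−2a_{2n+1} + 3b_{2n+1} + 2λ1)/(−2a_{2n+2} + 3b_{2n+2} + 2λ1). Then for even n, c_n = (n+2)(n+4)²(n+6)(n+2μ2)(n+2+2μ2)(n+4+2μ2)(n+6+2μ2) / (3072 μ2 (1+μ2)(2+μ2)(3+μ2)), and for odd n, c_n = −(n+1)(n+3)(n+5)(n+7)(n+1+2μ2)(n+3+2μ2)²(n+5+2μ2)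 / (3072 μ2 (1+μ2)(2+μ2)(3+μ2)). -/
/-- Closed form of the compensation constants, with `μ2 = λ2/(λ1+λ2)`. -/
noncomputable def cSeq (mu : ℝ) (n : ℕ) : ℝ :=
  if Even n then
    ((n : ℝ) + 2) * ((n : ℝ) + 4) ^ 2 * ((n : ℝ) + 6) * ((n : ℝ) + 2 * mu)
      * ((n : ℝ) + 2 + 2 * mu) * ((n : ℝ) + 4 + 2 * mu) * ((n : ℝ) + 6 + 2 * mu)
      / (3072 * mu * (1 + mu) * (2 + mu) * (3 + mu))
  else
    -(((n : ℝ) + 1) * ((n : ℝ) + 3) * ((n : ℝ) + 5) * ((n : ℝ) + 7) * ((n : ℝ) + 1 + 2 * mu)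
        * ((n : ℝ) + 3 + 2 * mu) ^ 2 * ((n : ℝ) + 5 + 2 * mu))
      / (3072 * mu * (1 + mu) * (2 + mu) * (3 + mu))

lemma aSeq_two_mul (l1 l2 : ℝ) (m : ℕ) :
    aSeq l1 l2 (2 * m) = (m + 2) * (l1 * (m + 2) + l2 * (m + 3)) := by
  simp only [aSeq, Nat.mul_div_cancel_left m two_pos]
  ring

lemma aSeq_two_mul_add_one (l1 l2 : ℝ) (m : ℕ) :
    aSeq l1 l2 (2 * m + 1) = (m + 2) * (l1 * (m + 2) + l2 * (m + 3)) := by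
  have h : (2 * m + 1) / 2 = m := by omega
  simp only [aSeq, h]
  ring

lemma bSeq_two_mul (l1 l2 : ℝ) (m : ℕ) :
    bSeq l1 l2 (2 * m) = (m + 2) * (l1 * (m + 1) + l2 * (m + 2)) := by
  simp only [bSeq, even_two_mul, if_true, Nat.mul_div_cancel_left m two_pos]
  ring

lemma bSeq_two_mul_add_one (l1 l2 : ℝ) (m : ℕ) :
    bSeq l1 l2 (2 * m + 1) = (m + 3) * (l1 * (m + 2) + l2 * (m + 3)) := by
  have h : (2 * m + 1) / 2 = m := by omega
  simp only [bSeq, Nat.not_even_two_mul_add_one, if_false, h]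
  ring

lemma cSeq_two_mul (mu : ℝ) (m : ℕ) :
    cSeq mu (2 * m) = (m + 1) * (m + 2) ^ 2 * (m + 3) * (m + mu) * (m + 1 + mu) * (m + 2 + mu)
      * (m + 3 + mu) / (12 * mu * (1 + mu) * (2 + mu) * (3 + mu)) := by
  simp only [cSeq, even_two_mul, if_true]
  push_cast
  rw [← mul_div_mul_left _ (12 * mu * (1 + mu) * (2 + mu) * (3 + mu)) (c := 256) (by norm_num)]
  ring_nf

lemma cSeq_two_mul_add_one (mu : ℝ) (m : ℕ) :
    cSeq mu (2 * m + 1) = -((m + 1) * (m + 2) * (m + 3) * (m + 4) * (m + 1 + mu)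
      * (m + 2 + mu) ^ 2 * (m + 3 + mu)) / (12 * mu * (1 + mu) * (2 + mu) * (3 + mu)) := by
  simp only [cSeq, Nat.not_even_two_mul_add_one, if_false]
  push_cast
  rw [← mul_div_mul_left _ (12 * mu * (1 + mu) * (2 + mu) * (3 + mu)) (c := 256) (by norm_num)]
  ring_nf

lemma cSeq_zero {mu : ℝ} (hmu : 0 < mu) : cSeq mu 0 = 1 := by
  have h := cSeq_two_mul mu 0
  rw [mul_zero] at h
  rw [h]
  push_cast
  field_simp
  ring

/-- The closed form satisfies the first half of the compensation recursion. -/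
lemma cSeq_odd_recursion {l1 l2 : ℝ} (hl1 : 0 < l1) (hl2 : 0 < l2) (m : ℕ) :
    cSeq (l2 / (l1 + l2)) (2 * m + 1)
      = -cSeq (l2 / (l1 + l2)) (2 * m)
          * (3 * aSeq l1 l2 (2 * m) - 2 * bSeq l1 l2 (2 * m) + 2 * l2)
          / (3 * aSeq l1 l2 (2 * m + 1) - 2 * bSeq l1 l2 (2 * m + 1) + 2 * l2) := by
  have hs : 0 < l1 + l2 := add_pos hl1 hl2
  have hmu : 0 < l2 / (l1 + l2) := div_pos hl2 hs
  have hl : l2 = (l1 + l2) * (l2 / (l1 + l2)) := by field_simp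
  have hnum : 3 * aSeq l1 l2 (2 * m) - 2 * bSeq l1 l2 (2 * m) + 2 * l2
      = (m + 4) * ((l1 + l2) * (m + 2 + l2 / (l1 + l2))) := by
    rw [aSeq_two_mul, bSeq_two_mul, mul_add (l1 + l2), ← hl]
    ring
  have hden : 3 * aSeq l1 l2 (2 * m + 1) - 2 * bSeq l1 l2 (2 * m + 1) + 2 * l2
      = (m + 2) * ((l1 + l2) * (m + l2 / (l1 + l2))) := by
    rw [aSeq_two_mul_add_one, bSeq_two_mul_add_one, mul_add (l1 + l2), ← hl]
    ring
  rw [hnum, hden, cSeq_two_mul, cSeq_two_mul_add_one]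
  generalize l2 / (l1 + l2) = mu at hmu
  generalize l1 + l2 = s at hs
  field_simp

/-- The closed form satisfies the second half of the compensation recursion. -/
lemma cSeq_even_recursion {l1 l2 : ℝ} (hl1 : 0 < l1) (hl2 : 0 < l2) (m : ℕ) :
    cSeq (l2 / (l1 + l2)) (2 * m + 2)
      = -cSeq (l2 / (l1 + l2)) (2 * m + 1)
          * (-2 * aSeq l1 l2 (2 * m + 1) + 3 * bSeq l1 l2 (2 * m + 1) + 2 * l1)
          / (-2 * aSeq l1 l2 (2 * m + 2) + 3 * bSeq l1 l2 (2 * m + 2) + 2 * l1) := by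
  have hs : 0 < l1 + l2 := add_pos hl1 hl2
  have hmu : 0 < l2 / (l1 + l2) := div_pos hl2 hs
  have hl : l2 = (l1 + l2) * (l2 / (l1 + l2)) := by field_simp
  have hnum : -2 * aSeq l1 l2 (2 * m + 1) + 3 * bSeq l1 l2 (2 * m + 1) + 2 * l1
      = (m + 3) * ((l1 + l2) * (m + 4 + l2 / (l1 + l2))) := by
    rw [aSeq_two_mul_add_one, bSeq_two_mul_add_one, mul_add (l1 + l2), ← hl]
    ring
  have hden : -2 * aSeq l1 l2 (2 * m + 2) + 3 * bSeq l1 l2 (2 * m + 2) + 2 * l1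
      = (m + 1) * ((l1 + l2) * (m + 2 + l2 / (l1 + l2))) := by
    rw [← Nat.mul_succ, aSeq_two_mul, bSeq_two_mul, mul_add (l1 + l2), ← hl]
    push_cast
    ring
  rw [hnum, hden, ← Nat.mul_succ, cSeq_two_mul, cSeq_two_mul_add_one]
  generalize l2 / (l1 + l2) = mu at hmu
  generalize l1 + l2 = s at hs
  push_cast
  field_simp
  ring

/-- If `(c_n)` satisfies `c_0 = 1` together with the compensation recursion
`c_{2n+1} = −c_{2n} (3a_{2n} − 2b_{2n} + 2λ2)/(3a_{2n+1} − 2b_{2n+1} + 2λ2)` and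
`c_{2n+2} = −c_{2n+1} (−2a_{2n+1} + 3b_{2n+1} + 2λ1)/(−2a_{2n+2} + 3b_{2n+2} + 2λ1)`,
then `c_n` is given by the closed form `cSeq μ2 n` with `μ2 = λ2/(λ1+λ2)`. -/
theorem compensation_constants_closed_form (l1 l2 : ℝ) (hl1 : 0 < l1) (hl2 : 0 < l2)
    (c : ℕ → ℝ) (hc0 : c 0 = 1)
    (hodd : ∀ n : ℕ, c (2 * n + 1)
      = -c (2 * n) * (3 * aSeq l1 l2 (2 * n) - 2 * bSeq l1 l2 (2 * n) + 2 * l2)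
          / (3 * aSeq l1 l2 (2 * n + 1) - 2 * bSeq l1 l2 (2 * n + 1) + 2 * l2))
    (heven : ∀ n : ℕ, c (2 * n + 2)
      = -c (2 * n + 1)
          * (-2 * aSeq l1 l2 (2 * n + 1) + 3 * bSeq l1 l2 (2 * n + 1) + 2 * l1)
          / (-2 * aSeq l1 l2 (2 * n + 2) + 3 * bSeq l1 l2 (2 * n + 2) + 2 * l1)) :
    ∀ n : ℕ, c n = cSeq (l2 / (l1 + l2)) n := by
  have even_eq (m : ℕ) : c (2 * m) = cSeq (l2 / (l1 + l2)) (2 * m) := by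
    induction m with
    | zero => rw [mul_zero, hc0, cSeq_zero (div_pos hl2 (add_pos hl1 hl2))]
    | succ m ih =>
      rw [Nat.mul_succ, heven, hodd, ih, ← cSeq_odd_recursion hl1 hl2,
        ← cSeq_even_recursion hl1 hl2]
  intro n
  obtain ⟨m, rfl | rfl⟩ := n.even_or_odd'
  · exact even_eq m
  · rw [hodd, even_eq, ← cSeq_odd_recursion hl1 hl2]
end

section
/- Let μ1 ∈ (0,1) and μ2 = 1 − μ1. Then ∏_{k∈ℤ, |k|≥2} k(k+μ2) / ( k(k+μ2) − μ1 ) = 2(1+μ1)/(1+μ2), where the doubly infinite product converges. -/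
open Filter Topology

/-- A real sequence with `1 ≤ f n ≤ 1 + 1 / (n + 1) ^ 2` is unconditionally multipliable, so its
product is the limit of its partial products. -/
lemma hasProd_of_le_one_add_of_tendsto {f : ℕ → ℝ} {L : ℝ} (h1 : ∀ n, 1 ≤ f n)
    (h2 : ∀ n, f n ≤ 1 + 1 / ((n : ℝ) + 1) ^ 2)
    (hL : Tendsto (fun N => ∏ n ∈ Finset.range N, f n) atTop (𝓝 L)) : HasProd f L := by
  have hs : Summable fun n : ℕ => 1 / ((n : ℝ) + 1) ^ 2 := by
    have := (summable_nat_add_iff 1).2 (Real.summable_one_div_nat_pow.2 one_lt_two)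
    simpa using this
  have hs' : Summable fun n => f n - 1 :=
    hs.of_nonneg_of_le (fun n => by linarith [h1 n]) (fun n => by linarith [h2 n])
  have hm : Multipliable f := by
    simpa using Real.multipliable_one_add_of_summable hs'
  rw [← tendsto_nhds_unique hm.hasProd.tendsto_prod_nat hL]
  exact hm.hasProd

lemma hasProd_factor_nat_add_two {a : ℝ} (h0 : 0 < a) (h1 : a < 1) :
    HasProd (fun n : ℕ => ((n : ℝ) + 2) * (n + 2 + (1 - a)) / ((n + 2) * (n + 2 + (1 - a)) - a))
      (2 / (2 - a)) := by
  have key (n : ℕ) : ((n : ℝ) + 2) * (n + 2 + (1 - a)) - a = (n + 3) * (n + 2 - a) := by ring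
  have hn (n : ℕ) : (0 : ℝ) ≤ n := n.cast_nonneg
  have hpos (n : ℕ) : (0 : ℝ) < n + 2 - a := by linarith [hn n]
  have hfac (n : ℕ) : ((n : ℝ) + 2) * (n + 2 + (1 - a)) / ((n + 2) * (n + 2 + (1 - a)) - a)
      = 1 + a / ((n + 3) * (n + 2 - a)) := by
    have := hpos n
    have := hn n
    rw [key]
    field_simp
    ring
  refine hasProd_of_le_one_add_of_tendsto (fun n => ?_) (fun n => ?_) ?_
  · rw [hfac]
    have := hpos n
    have : 0 ≤ a / (((n : ℝ) + 3) * (n + 2 - a)) := by positivity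
    linarith
  · rw [hfac]
    gcongr
    have := hn n
    nlinarith
  · have hprod (N : ℕ) : ∏ n ∈ Finset.range N,
        ((n : ℝ) + 2) * (n + 2 + (1 - a)) / ((n + 2) * (n + 2 + (1 - a)) - a)
        = 2 / (2 - a) * (1 - a * (1 / ((N : ℝ) + 2))) := by
      have h2 : 2 - a ≠ 0 := by linarith
      induction N with
      | zero => simp; field_simp
      | succ N ih =>
        have := hpos N
        have := hn N
        rw [Finset.prod_range_succ, ih, key]
        push_cast
        field_simp
        ring
    simp_rw [hprod]
    have hlim : Tendsto (fun N : ℕ => 1 / ((N : ℝ) + 2)) atTop (𝓝 0) := by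
      exact tendsto_const_nhds.div_atTop
        (tendsto_atTop_add_const_right _ (2 : ℝ) tendsto_natCast_atTop_atTop)
    simpa using ((hlim.const_mul a).const_sub 1).const_mul (2 / (2 - a))

lemma hasProd_factor_neg_nat_add_two {a : ℝ} (h0 : 0 < a) (h1 : a < 1) :
    HasProd (fun n : ℕ =>
      (-((n : ℝ) + 2)) * (-(n + 2) + (1 - a)) / ((-(n + 2)) * (-(n + 2) + (1 - a)) - a))
      (1 + a) := by
  have key (n : ℕ) : (-((n : ℝ) + 2)) * (-(n + 2) + (1 - a)) - a = (n + 1) * (n + 2 + a) := by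
    ring
  have hn (n : ℕ) : (0 : ℝ) ≤ n := n.cast_nonneg
  have hfac (n : ℕ) :
      (-((n : ℝ) + 2)) * (-(n + 2) + (1 - a)) / ((-(n + 2)) * (-(n + 2) + (1 - a)) - a)
      = 1 + a / ((n + 1) * (n + 2 + a)) := by
    have := hn n
    rw [key]
    field_simp
    ring
  refine hasProd_of_le_one_add_of_tendsto (fun n => ?_) (fun n => ?_) ?_
  · rw [hfac]
    have : 0 ≤ a / (((n : ℝ) + 1) * (n + 2 + a)) := by positivity
    linarith
  · rw [hfac]
    gcongr
    have := hn n
    nlinarith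
  · have hprod (N : ℕ) : ∏ n ∈ Finset.range N,
        (-((n : ℝ) + 2)) * (-(n + 2) + (1 - a)) / ((-(n + 2)) * (-(n + 2) + (1 - a)) - a)
        = (1 + a) * (1 - a * (1 / ((N : ℝ) + (1 + a)))) := by
      induction N with
      | zero => simp; field_simp; ring
      | succ N ih =>
        have := hn N
        have : (N : ℝ) + (1 + a) ≠ 0 := by positivity
        have : (N : ℝ) + 1 + (1 + a) ≠ 0 := by positivity
        have : (N : ℝ) + 2 + a ≠ 0 := by positivity
        rw [Finset.prod_range_succ, ih, key]
        push_cast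
        field_simp
        ring
    simp_rw [hprod]
    have hlim : Tendsto (fun N : ℕ => 1 / ((N : ℝ) + (1 + a))) atTop (𝓝 0) := by
      exact tendsto_const_nhds.div_atTop
        (tendsto_atTop_add_const_right _ (1 + a) tendsto_natCast_atTop_atTop)
    simpa using ((hlim.const_mul a).const_sub 1).const_mul (1 + a)

/-- A product over the integers `k` with `2 ≤ |k|` splits into its positive and negative parts. -/
lemma hasProd_subtype_two_le_abs {f : ℤ → ℝ} {p q : ℝ}
    (hp : HasProd (fun n : ℕ => f (n + 2)) p) (hq : HasProd (fun n : ℕ => f (-(n + 2))) q) :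
    HasProd (fun k : {k : ℤ // 2 ≤ |k|} => f k) (p * q) := by
  refine (hasProd_subtype_iff_mulIndicator (s := {k : ℤ | 2 ≤ |k|})).2 ?_
  refine HasProd.of_nat_of_neg_add_one ?_ ?_
  · refine ((add_left_injective 2).hasProd_iff fun n hn => ?_).1 ?_
    · refine Set.mulIndicator_of_notMem (s := {k : ℤ | 2 ≤ |k|}) (fun h => hn ⟨n - 2, ?_⟩) f
      grind
    · convert hp using 2 with n
      simp only [Function.comp_apply, Nat.cast_add, Nat.cast_ofNat]
      exact Set.mulIndicator_of_mem (s := {k : ℤ | 2 ≤ |k|}) (by grind) f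
  · refine ((add_left_injective 1).hasProd_iff fun n hn => ?_).1 ?_
    · refine Set.mulIndicator_of_notMem (s := {k : ℤ | 2 ≤ |k|}) (fun h => hn ⟨n - 1, ?_⟩) f
      grind
    · convert hq using 2 with n
      simp only [Function.comp_apply, Nat.cast_add, Nat.cast_one, add_assoc, one_add_one_eq_two]
      exact Set.mulIndicator_of_mem (s := {k : ℤ | 2 ≤ |k|}) (by grind) f

/-- For `μ1 ∈ (0,1)` and `μ2 = 1 − μ1`,
`∏_{k∈ℤ, |k|≥2} k(k+μ2)/(k(k+μ2) − μ1) = 2(1+μ1)/(1+μ2)`,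
where the doubly infinite product converges. -/
theorem telescopic_product (mu1 : ℝ) (hmu1 : mu1 ∈ Set.Ioo (0:ℝ) 1)
    (mu2 : ℝ) (hmu2 : mu2 = 1 - mu1) :
    Multipliable (fun k : {k : ℤ // 2 ≤ |k|} =>
      (k : ℝ) * ((k : ℝ) + mu2) / ((k : ℝ) * ((k : ℝ) + mu2) - mu1)) ∧
    ∏' k : {k : ℤ // 2 ≤ |k|},
        (k : ℝ) * ((k : ℝ) + mu2) / ((k : ℝ) * ((k : ℝ) + mu2) - mu1)
      = 2 * (1 + mu1) / (1 + mu2) := by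
  subst hmu2
  have h := hasProd_subtype_two_le_abs
    (f := fun k : ℤ => (k : ℝ) * ((k : ℝ) + (1 - mu1)) / ((k : ℝ) * ((k : ℝ) + (1 - mu1)) - mu1))
    (by simpa only [Int.cast_add, Int.cast_natCast, Int.cast_ofNat] using
      hasProd_factor_nat_add_two hmu1.1 hmu1.2)
    (by simpa only [Int.cast_neg, Int.cast_add, Int.cast_natCast, Int.cast_ofNat] using
      hasProd_factor_neg_nat_add_two hmu1.1 hmu1.2)
  refine ⟨h.multipliable, h.tprod_eq.trans ?_⟩
  rw [show 1 + (1 - mu1) = 2 - mu1 by ring]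
  ring
end
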